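/- Let ρ be a quantum state on a finite-dimensional complex Hilbert space H, let {S_n}_{n≥1} satisfy Assumption 1, and suppose S_1 contains a state whose support contains supp(ρ). Assume further that for each n all operators in S_n mutually commute and each commutes with ρ^{⊗n}. Then for every r > 0 the strong converse exponent satisfies sc_r(ρ‖{S_n}) = sup_{1 ≤ α ≤ +∞} sup_{σ ∈ S_1} ((α−1)/α)(r − D̃_α(ρ‖σ)), where (α−1)/α is interpreted as 1 at α = +∞ and D̃_∞ is the limit of D̃_α as α → +∞. -/

import Mathlib

open scoped BigOperators ComplexOrder Classical
open MeasureTheory Filter Set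

noncomputable section

namespace QHT

variable {ι : Type*} [Fintype ι] [DecidableEq ι]

/-- Generalized matrix power `A ^ w` (complex exponent `w`) of a Hermitian matrix,
via functional calculus on the support: the eigenvalue `0` is mapped to `0`. -/
def mpow (A : Matrix ι ι ℂ) (w : ℂ) : Matrix ι ι ℂ :=
  if hA : A.IsHermitian then
    (hA.eigenvectorUnitary : Matrix ι ι ℂ) *
      Matrix.diagonal (fun i => if hA.eigenvalues i = 0 then 0 else (hA.eigenvalues i : ℂ) ^ w) *
      star (hA.eigenvectorUnitary : Matrix ι ι ℂ)
  else 0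

/-- Matrix logarithm of a Hermitian matrix, taken on its support
(`Real.log 0 = 0`, so the kernel is mapped to `0`). -/
def mlog (A : Matrix ι ι ℂ) : Matrix ι ι ℂ :=
  if hA : A.IsHermitian then
    (hA.eigenvectorUnitary : Matrix ι ι ℂ) *
      Matrix.diagonal (fun i => (Real.log (hA.eigenvalues i) : ℂ)) *
      star (hA.eigenvectorUnitary : Matrix ι ι ℂ)
  else 0

/-- The support of a matrix, i.e. its range as a linear map. -/
def msupp (A : Matrix ι ι ℂ) : Submodule ℂ (ι → ℂ) := LinearMap.range A.mulVecLin

/-- A quantum state: a positive semidefinite matrix of trace one. -/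
def IsState (A : Matrix ι ι ℂ) : Prop := A.PosSemidef ∧ A.trace = 1

/-- Real part of the trace. -/
def rtr (A : Matrix ι ι ℂ) : ℝ := A.trace.re

/-- The Umegaki relative entropy `D(ρ‖σ)`, with value `+∞` when `supp ρ ⊄ supp σ`. -/
def relEnt (ρ σ : Matrix ι ι ℂ) : EReal :=
  if msupp ρ ≤ msupp σ then ((rtr (ρ * (mlog ρ - mlog σ)) : ℝ) : EReal) else ⊤

/-- The polar of a set of matrices (intersected with the PSD cone). -/
def polar (S : Set (Matrix ι ι ℂ)) : Set (Matrix ι ι ℂ) :=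
  {X | X.PosSemidef ∧ ∀ Y ∈ S, rtr (X * Y) ≤ 1}

/-- Entrywise Bochner integral of a matrix-valued function over `ℝ`. -/
def mInt (f : ℝ → Matrix ι ι ℂ) : Matrix ι ι ℂ :=
  Matrix.of fun i j => ∫ t : ℝ, f t i j

/-- Entrywise Bochner integral of a matrix-valued function over a set `s ⊆ ℝ`. -/
def mIntOn (f : ℝ → Matrix ι ι ℂ) (s : Set ℝ) : Matrix ι ι ℂ :=
  Matrix.of fun i j => ∫ t in s, f t i j

/-- `sinc` function. -/
def sinc (s : ℝ) : ℝ := if s = 0 then 1 else Real.sin s / s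

/-- The probability density `β_θ` from the paper (`β₀` is the `θ → 0` limit). -/
def betaDist (θ t : ℝ) : ℝ :=
  if θ = 0 then Real.pi / (2 * (Real.cosh (Real.pi * t) + 1))
  else Real.sin (θ * Real.pi) / (2 * θ * (Real.cosh (Real.pi * t) + Real.cos (θ * Real.pi)))

/-- `Q_{α,z}(ρ‖σ) = Tr[(ρ^{α/2z} σ^{(1-α)/z} ρ^{α/2z})^z]`. -/
def Qaz (α z : ℝ) (ρ σ : Matrix ι ι ℂ) : ℝ :=
  rtr (mpow (mpow ρ ((α / (2 * z) : ℝ) : ℂ) * mpow σ (((1 - α) / z : ℝ) : ℂ) *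
      mpow ρ ((α / (2 * z) : ℝ) : ℂ)) ((z : ℝ) : ℂ))

/-- The `α`-`z` Rényi relative entropy. -/
def Daz (α z : ℝ) (ρ σ : Matrix ι ι ℂ) : EReal :=
  if (α < 1 ∧ (ρ * σ).trace ≠ 0) ∨ msupp ρ ≤ msupp σ then
    (((α - 1)⁻¹ * Real.log (Qaz α z ρ σ) : ℝ) : EReal)
  else ⊤

/-- `Q_α(ρ‖σ) = Tr[ρ^α σ^{1-α}]` (Petz). -/
def Qpetz (α : ℝ) (ρ σ : Matrix ι ι ℂ) : ℝ :=
  rtr (mpow ρ ((α : ℝ) : ℂ) * mpow σ (((1 - α) : ℝ) : ℂ))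

/-- The Petz Rényi divergence. -/
def Dpetz (α : ℝ) (ρ σ : Matrix ι ι ℂ) : EReal :=
  if (α < 1 ∧ (ρ * σ).trace ≠ 0) ∨ msupp ρ ≤ msupp σ then
    (((α - 1)⁻¹ * Real.log (Qpetz α ρ σ) : ℝ) : EReal)
  else ⊤

/-- `Q̃_α(ρ‖σ) = Tr[(σ^{(1-α)/2α} ρ σ^{(1-α)/2α})^α]` (sandwiched). -/
def Qsand (α : ℝ) (ρ σ : Matrix ι ι ℂ) : ℝ :=
  rtr (mpow (mpow σ (((1 - α) / (2 * α) : ℝ) : ℂ) * ρ * mpow σ (((1 - α) / (2 * α) : ℝ) : ℂ))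
    ((α : ℝ) : ℂ))

/-- The sandwiched Rényi divergence. -/
def Dsand (α : ℝ) (ρ σ : Matrix ι ι ℂ) : EReal :=
  if (α < 1 ∧ (ρ * σ).trace ≠ 0) ∨ msupp ρ ≤ msupp σ then
    (((α - 1)⁻¹ * Real.log (Qsand α ρ σ) : ℝ) : EReal)
  else ⊤

/-- `D̃_∞(ρ‖σ)`: the limit of `D̃_α(ρ‖σ)` as `α → +∞` (encoded as a `limsup`; the limit
exists by monotonicity in `α`). -/
def DsandInf (ρ σ : Matrix ι ι ℂ) : EReal :=
  Filter.limsup (fun α : ℝ => Dsand α ρ σ) Filter.atTop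

/-- `χ_{α,z}(ρ,σ) = ρ^{α/2z} (ρ^{α/2z} σ^{(1-α)/z} ρ^{α/2z})^{z-1} ρ^{α/2z}`. -/
def chi (α z : ℝ) (ρ σ : Matrix ι ι ℂ) : Matrix ι ι ℂ :=
  mpow ρ ((α / (2 * z) : ℝ) : ℂ) *
    mpow (mpow ρ ((α / (2 * z) : ℝ) : ℂ) * mpow σ (((1 - α) / z : ℝ) : ℂ) *
      mpow ρ ((α / (2 * z) : ℝ) : ℂ)) (((z - 1 : ℝ)) : ℂ) *
    mpow ρ ((α / (2 * z) : ℝ) : ℂ)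

/-- The data-processing region `𝒟` for `α`-`z` Rényi relative entropies. -/
def Dregion : Set (ℝ × ℝ) :=
  {p | (0 < p.1 ∧ p.1 < 1 ∧ max p.1 (1 - p.1) ≤ p.2) ∨
       (1 < p.1 ∧ max (p.1 / 2) (p.1 - 1) ≤ p.2 ∧ p.2 ≤ p.1) ∨
       (p.1 = 1 ∧ 0 < p.2)}

end QHT

namespace QHT

variable {ι : Type*} [Fintype ι] [DecidableEq ι]

/-! ### Tensor products and many copies -/

/-- Tensor product of a `d₁`- and a `d₂`-dimensional operator, as a `d₁d₂`-dimensional one. -/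
def dtens {a b : ℕ} (A : Matrix (Fin a) (Fin a) ℂ) (B : Matrix (Fin b) (Fin b) ℂ) :
    Matrix (Fin (a * b)) (Fin (a * b)) ℂ :=
  Matrix.of fun x y =>
    A (finProdFinEquiv.symm x).1 (finProdFinEquiv.symm y).1 *
      B (finProdFinEquiv.symm x).2 (finProdFinEquiv.symm y).2

/-- `ρ^{⊗n}` of a `d`-dimensional operator, as a `d^n`-dimensional operator. -/
def dpow {d : ℕ} (ρ : Matrix (Fin d) (Fin d) ℂ) (n : ℕ) :
    Matrix (Fin (d ^ n)) (Fin (d ^ n)) ℂ :=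
  Matrix.of fun x y => ∏ i, ρ (finFunctionFinEquiv.symm x i) (finFunctionFinEquiv.symm y i)

/-- The action of a permutation of the `k` tensor factors on an operator on `(ℂ^d)^{⊗k}`. -/
def permMat (d k : ℕ) (π : Equiv.Perm (Fin k)) (A : Matrix (Fin (d ^ k)) (Fin (d ^ k)) ℂ) :
    Matrix (Fin (d ^ k)) (Fin (d ^ k)) ℂ :=
  Matrix.of fun x y =>
    A (finFunctionFinEquiv ((finFunctionFinEquiv.symm x) ∘ π))
      (finFunctionFinEquiv ((finFunctionFinEquiv.symm y) ∘ π))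

/-- `ρ^{⊗n}` of a `d`-dimensional operator, as an operator on `H^{⊗n}` with `H = ℂ^d`,
indexed by tuples. -/
def tpow {d : ℕ} (ρ : Matrix (Fin d) (Fin d) ℂ) (n : ℕ) :
    Matrix (Fin n → Fin d) (Fin n → Fin d) ℂ :=
  Matrix.of fun x y => ∏ i, ρ (x i) (y i)

/-- Tensor product of an operator on `H^{⊗m}` and an operator on `H^{⊗n}`, as an
operator on `H^{⊗(m+n)}`. -/
def tensOp {d m n : ℕ} (A : Matrix (Fin m → Fin d) (Fin m → Fin d) ℂ)
    (B : Matrix (Fin n → Fin d) (Fin n → Fin d) ℂ) :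
    Matrix (Fin (m + n) → Fin d) (Fin (m + n) → Fin d) ℂ :=
  Matrix.of fun x y =>
    A (fun i => x (Fin.castAdd n i)) (fun i => y (Fin.castAdd n i)) *
      B (fun j => x (Fin.natAdd m j)) (fun j => y (Fin.natAdd m j))

/-- Permutation action on operators on `H^{⊗k}`. -/
def permOp {d k : ℕ} (π : Equiv.Perm (Fin k))
    (A : Matrix (Fin k → Fin d) (Fin k → Fin d) ℂ) :
    Matrix (Fin k → Fin d) (Fin k → Fin d) ℂ :=
  Matrix.of fun x y => A (x ∘ π) (y ∘ π)

/-! ### Hypothesis testing -/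

/-- A test: an operator `T` with `0 ≤ T ≤ I`. -/
def IsTest (T : Matrix ι ι ℂ) : Prop := T.PosSemidef ∧ (1 - T).PosSemidef

/-- Type I error `α_n(ρ|T) = Tr[(I - T) ρ^{⊗n}]`. -/
def typeI {d : ℕ} (ρ : Matrix (Fin d) (Fin d) ℂ) (n : ℕ)
    (T : Matrix (Fin n → Fin d) (Fin n → Fin d) ℂ) : ℝ :=
  rtr ((1 - T) * tpow ρ n)

/-- Type II error `β_n(S|T) = sup_{σ ∈ S} Tr[σ T]`. -/
def typeII {d n : ℕ} (S : Set (Matrix (Fin n → Fin d) (Fin n → Fin d) ℂ))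
    (T : Matrix (Fin n → Fin d) (Fin n → Fin d) ℂ) : ℝ :=
  sSup ((fun σ => rtr (σ * T)) '' S)

/-- `- log x`, valued in `EReal`, with `- log x = +∞` for `x ≤ 0`. -/
def negLog (x : ℝ) : EReal := if x ≤ 0 then ⊤ else ((- Real.log x : ℝ) : EReal)

/-- The exponential rate `-(1/n) log x`. -/
def rate (n : ℕ) (x : ℝ) : EReal := (((n : ℝ)⁻¹ : ℝ) : EReal) * negLog x

/-- The Stein exponent `s(ρ‖{S_n})`. -/
def steinExp {d : ℕ} (ρ : Matrix (Fin d) (Fin d) ℂ)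
    (S : (n : ℕ) → Set (Matrix (Fin n → Fin d) (Fin n → Fin d) ℂ)) : EReal :=
  sSup ((fun r : ℝ => (r : EReal)) ''
    {r : ℝ | 0 ≤ r ∧ ∃ T : (n : ℕ) → Matrix (Fin n → Fin d) (Fin n → Fin d) ℂ,
      (∀ n, IsTest (T n)) ∧
      (r : EReal) ≤ Filter.liminf (fun n => rate n (typeII (S n) (T n))) Filter.atTop ∧
      Filter.Tendsto (fun n => typeI ρ n (T n)) Filter.atTop (nhds 0)})

/-- The Chernoff exponent `c(ρ‖{S_n})`. -/
def chernoffExp {d : ℕ} (ρ : Matrix (Fin d) (Fin d) ℂ)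
    (S : (n : ℕ) → Set (Matrix (Fin n → Fin d) (Fin n → Fin d) ℂ)) : EReal :=
  Filter.liminf (fun n =>
    rate n (sInf ((fun T => typeI ρ n T + typeII (S n) T) '' {T | IsTest T}))) Filter.atTop

/-- The Hoeffding (direct) exponent `d_r(ρ‖{S_n})`. -/
def hoeffdingExp {d : ℕ} (r : ℝ) (ρ : Matrix (Fin d) (Fin d) ℂ)
    (S : (n : ℕ) → Set (Matrix (Fin n → Fin d) (Fin n → Fin d) ℂ)) : EReal :=
  ⨆ T : {T : (n : ℕ) → Matrix (Fin n → Fin d) (Fin n → Fin d) ℂ //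
      (∀ n, IsTest (T n)) ∧
      (r : EReal) ≤ Filter.liminf (fun n => rate n (typeII (S n) (T n))) Filter.atTop},
    Filter.liminf (fun n => rate n (typeI ρ n (T.1 n))) Filter.atTop

/-- The strong converse exponent `sc_r(ρ‖{S_n})`. -/
def scExp {d : ℕ} (r : ℝ) (ρ : Matrix (Fin d) (Fin d) ℂ)
    (S : (n : ℕ) → Set (Matrix (Fin n → Fin d) (Fin n → Fin d) ℂ)) : EReal :=
  ⨅ T : {T : (n : ℕ) → Matrix (Fin n → Fin d) (Fin n → Fin d) ℂ //
      (∀ n, IsTest (T n)) ∧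
      (r : EReal) ≤ Filter.liminf (fun n => rate n (typeII (S n) (T n))) Filter.atTop},
    Filter.limsup (fun n => rate n (1 - typeI ρ n (T.1 n))) Filter.atTop

/-- Assumption 1 of the paper for a family `{S_n}_{n ≥ 1}` of sets of operators
on `H^{⊗n}`, `H = ℂ^d`: each `S_n` is a convex compact set of positive semidefinite
operators, closed under tensor products, and with polar sets closed under tensor
products. -/
structure Assumption1 {d : ℕ}
    (S : (n : ℕ) → Set (Matrix (Fin n → Fin d) (Fin n → Fin d) ℂ)) : Prop where
  psd : ∀ n, 1 ≤ n → ∀ X ∈ S n, X.PosSemidef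
  convex : ∀ n, 1 ≤ n → Convex ℝ (S n)
  compact : ∀ n, 1 ≤ n → IsCompact (S n)
  tens : ∀ m n, 1 ≤ m → 1 ≤ n → ∀ A ∈ S m, ∀ B ∈ S n, tensOp A B ∈ S (m + n)
  polarTens : ∀ m n, 1 ≤ m → 1 ≤ n →
    ∀ A ∈ polar (S m), ∀ B ∈ polar (S n), tensOp A B ∈ polar (S (m + n))

/-- Assumption 1′ of the paper for a dimension-indexed family `{S_d}_{d ≥ 1}`. -/
structure Assumption1' (S : (d : ℕ) → Set (Matrix (Fin d) (Fin d) ℂ)) : Prop where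
  psd : ∀ d, 1 ≤ d → ∀ X ∈ S d, X.PosSemidef
  convex : ∀ d, 1 ≤ d → Convex ℝ (S d)
  compact : ∀ d, 1 ≤ d → IsCompact (S d)
  tens : ∀ d₁ d₂, 1 ≤ d₁ → 1 ≤ d₂ → ∀ A ∈ S d₁, ∀ B ∈ S d₂, dtens A B ∈ S (d₁ * d₂)
  polarTens : ∀ d₁ d₂, 1 ≤ d₁ → 1 ≤ d₂ →
    ∀ A ∈ polar (S d₁), ∀ B ∈ polar (S d₂), dtens A B ∈ polar (S (d₁ * d₂))

end QHT

namespace QHT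

section Diagonalization

variable {ι : Type*} [Fintype ι] [DecidableEq ι]

/-- The Hermitian matrix with eigenbasis `U` and eigenvalues `a`. -/
def spec (U : Matrix ι ι ℂ) (a : ι → ℝ) : Matrix ι ι ℂ :=
  U * Matrix.diagonal (fun i => (a i : ℂ)) * star U

/-- A commuting family of Hermitian matrices has a common eigenbasis. -/
theorem exists_common_eigenbasis (C : Set (Matrix ι ι ℂ)) (hH : ∀ A ∈ C, A.IsHermitian)
    (hC : ∀ A ∈ C, ∀ B ∈ C, A * B = B * A) :
    ∃ U : Matrix ι ι ℂ, star U * U = 1 ∧ U * star U = 1 ∧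
      ∀ A ∈ C, ∃ a : ι → ℝ, A = spec U a := by
  let T : C → (EuclideanSpace ℂ ι →ₗ[ℂ] EuclideanSpace ℂ ι) := fun A => Matrix.toEuclideanLin A.1
  have hT : ∀ i, (T i).IsSymmetric := fun i =>
    Matrix.isSymmetric_toEuclideanLin_iff.2 (hH i.1 i.2)
  have hcomm : Pairwise (Function.onFun Commute T) := by
    intro A B _
    have h := hC A.1 A.2 B.1 B.2
    refine LinearMap.ext fun v => ?_
    simp only [T, Module.End.mul_apply, Matrix.toLpLin_apply, Matrix.mulVec_mulVec, h]
  let V : (C → ℂ) → Submodule ℂ (EuclideanSpace ℂ ι) :=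
    fun χ => ⨅ A, Module.End.eigenspace (T A) (χ A)
  have hV : OrthogonalFamily ℂ (fun χ => V χ) fun χ => (V χ).subtypeₗᵢ :=
    LinearMap.IsSymmetric.orthogonalFamily_iInf_eigenspaces hT
  have htop : ⨆ χ, V χ = ⊤ := LinearMap.IsSymmetric.iSup_iInf_eq_top_of_commute hT hcomm
  let κ := {χ : C → ℂ // V χ ≠ ⊥}
  have hfin : Finite κ := WellFoundedGT.finite_ne_bot_of_iSupIndep hV.independent
  have := Fintype.ofFinite κ
  have hV' : OrthogonalFamily ℂ (fun χ : κ => V χ.1) fun χ : κ => (V χ.1).subtypeₗᵢ :=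
    hV.comp Subtype.val_injective
  have hint : DirectSum.IsInternal (fun χ : κ => V χ.1) := by
    rw [hV'.isInternal_iff, Submodule.orthogonal_eq_bot_iff]
    exact (iSup_ne_bot_subtype V).trans htop
  let b := (hint.subordinateOrthonormalBasis (n := Fintype.card ι) (by simp) hV').reindex
    (Fintype.equivFin ι).symm
  have hb : ∀ j : ι, ∀ A : C, ∃ μ : ℂ, T A (b j) = μ • b j := by
    intro j A
    have h := hint.subordinateOrthonormalBasis_subordinate (n := Fintype.card ι) (by simp)
      (Fintype.equivFin ι j) hV'
    have hbj : b j = hint.subordinateOrthonormalBasis (by simp) hV' (Fintype.equivFin ι j) := by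
      simp [b]
    rw [hbj]
    exact ⟨_, Module.End.mem_eigenspace_iff.1 ((Submodule.mem_iInf _).1 h A)⟩
  let U : Matrix ι ι ℂ := Matrix.of fun i j => b j i
  have hU : star U * U = 1 := by
    ext i j
    have h := orthonormal_iff_ite.1 b.orthonormal i j
    simp only [PiLp.inner_apply] at h
    simpa [Matrix.mul_apply, U, Matrix.star_apply, Matrix.one_apply, mul_comm] using h
  have hU' : U * star U = 1 := mul_eq_one_comm.1 hU
  refine ⟨U, hU, hU', fun A hA => ?_⟩
  choose μ hμ using fun j => hb j ⟨A, hA⟩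
  have hAU : A * U = U * Matrix.diagonal μ := by
    ext i j
    have h := congrArg (fun v : EuclideanSpace ℂ ι => v i) (hμ j)
    rw [Matrix.mul_diagonal, Matrix.mul_apply]
    simpa [T, Matrix.toLpLin_apply, Matrix.mulVec, dotProduct, U, mul_comm] using h
  have hAe : A = U * Matrix.diagonal μ * star U := by
    rw [← hAU, mul_assoc, hU', mul_one]
  have hD : Matrix.diagonal μ = star U * A * U := by
    rw [mul_assoc, hAU, ← mul_assoc, hU, one_mul]
  have hDH : (Matrix.diagonal μ).IsHermitian := by
    rw [hD]
    exact Matrix.isHermitian_conjTranspose_mul_mul U (hH A hA)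
  have hμr : ∀ j, ((μ j).re : ℂ) = μ j := by
    intro j
    have h := congrFun (congrFun hDH j) j
    simp only [Matrix.conjTranspose_apply, Matrix.diagonal_apply_eq] at h
    exact Complex.conj_eq_iff_re.1 h
  exact ⟨fun j => (μ j).re, by simp only [spec, hμr]; exact hAe⟩

variable {U : Matrix ι ι ℂ}

theorem spec_apply_conj (hU : star U * U = 1) (a : ι → ℝ) :
    star U * spec U a * U = Matrix.diagonal (fun i => (a i : ℂ)) := by
  rw [spec, mul_assoc, mul_assoc, hU, mul_one, ← mul_assoc, hU, one_mul]

theorem spec_mul_spec (hU : star U * U = 1) (a b : ι → ℝ) :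
    spec U a * spec U b = spec U (fun i => a i * b i) := by
  calc spec U a * spec U b
      = U * Matrix.diagonal (fun i => (a i : ℂ)) * (star U * U) *
          Matrix.diagonal (fun i => (b i : ℂ)) * star U := by
        simp only [spec, mul_assoc]
    _ = _ := by
        rw [hU, mul_one, mul_assoc U, Matrix.diagonal_mul_diagonal]
        simp [spec]

theorem spec_isHermitian (a : ι → ℝ) : (spec U a).IsHermitian := by
  refine Matrix.isHermitian_mul_mul_conjTranspose U ?_
  ext i j
  by_cases h : i = j
  · subst h; simp
  · simp [h, Ne.symm h]

theorem spec_posSemidef {a : ι → ℝ} (ha : ∀ i, 0 ≤ a i) : (spec U a).PosSemidef := by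
  refine Matrix.PosSemidef.mul_mul_conjTranspose_same ?_ U
  exact Matrix.PosSemidef.diagonal fun i => by simpa using ha i

theorem nonneg_of_spec_posSemidef (hU : star U * U = 1) {a : ι → ℝ}
    (h : (spec U a).PosSemidef) (i : ι) : 0 ≤ a i := by
  have h2 := h.conjTranspose_mul_mul_same U
  rw [← Matrix.star_eq_conjTranspose, spec_apply_conj hU] at h2
  simpa using h2.diag_nonneg (i := i)

theorem rtr_spec (hU : star U * U = 1) (a : ι → ℝ) : rtr (spec U a) = ∑ i, a i := by
  rw [rtr, spec, Matrix.trace_mul_comm, ← mul_assoc, hU, one_mul, Matrix.trace_diagonal]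
  simp

theorem rtr_spec_mul (M : Matrix ι ι ℂ) (a : ι → ℝ) :
    rtr (spec U a * M) = ∑ i, a i * ((star U * M * U) i i).re := by
  have h : (spec U a * M).trace =
      (Matrix.diagonal (fun i => (a i : ℂ)) * (star U * M * U)).trace := by
    rw [spec, mul_assoc, mul_assoc, Matrix.trace_mul_comm]
    simp only [mul_assoc]
  rw [rtr, h, Matrix.trace, Complex.re_sum]
  refine Finset.sum_congr rfl fun i _ => ?_
  rw [Matrix.diag_apply, Matrix.diagonal_mul, Complex.re_ofReal_mul]

/-- The functional calculus underlying `mpow` does not depend on the eigenbasis. -/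
theorem mpow_spec (hU : star U * U = 1) (a : ι → ℝ) (w : ℂ) :
    mpow (spec U a) w =
      U * Matrix.diagonal (fun i => if a i = 0 then 0 else (a i : ℂ) ^ w) * star U := by
  have hA : (spec U a).IsHermitian := spec_isHermitian a
  have hU' : U * star U = 1 := mul_eq_one_comm.1 hU
  rw [mpow, dif_pos hA]
  set V : Matrix ι ι ℂ := (hA.eigenvectorUnitary : Matrix ι ι ℂ) with hVdef
  set l := hA.eigenvalues
  have hV : star V * V = 1 := Unitary.coe_star_mul_self hA.eigenvectorUnitary
  have hV' : V * star V = 1 := mul_eq_one_comm.1 hV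
  have hs : spec U a = V * Matrix.diagonal (fun i => (l i : ℂ)) * star V := by
    conv_lhs => rw [hA.spectral_theorem]
    rfl
  let f : ℝ → ℂ := fun x => if x = 0 then 0 else (x : ℂ) ^ w
  have hW : star U * V * Matrix.diagonal (fun i => (l i : ℂ)) =
      Matrix.diagonal (fun i => (a i : ℂ)) * (star U * V) := by
    calc star U * V * Matrix.diagonal (fun i => (l i : ℂ))
        = star U * (V * Matrix.diagonal (fun i => (l i : ℂ)) * star V) * V := by
          simp only [mul_assoc, hV, mul_one]
      _ = _ := by
          rw [← hs, spec]
          simp only [← mul_assoc, hU, one_mul]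
  have hWf : star U * V * Matrix.diagonal (fun i => f (l i)) =
      Matrix.diagonal (fun i => f (a i)) * (star U * V) := by
    ext i j
    have h := congrFun (congrFun hW i) j
    rw [Matrix.mul_diagonal, Matrix.diagonal_mul] at h ⊢
    by_cases hz : (star U * V) i j = 0
    · simp [hz]
    · have : l j = a i := by
        rw [mul_comm] at h
        exact_mod_cast mul_right_cancel₀ hz h
      rw [this, mul_comm]
  change V * Matrix.diagonal (fun i => f (l i)) * star V =
    U * Matrix.diagonal (fun i => f (a i)) * star U
  calc V * Matrix.diagonal (fun i => f (l i)) * star V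
      = U * (star U * V * Matrix.diagonal (fun i => f (l i))) * star V := by
        simp only [← mul_assoc, hU', one_mul]
    _ = U * Matrix.diagonal (fun i => f (a i)) * star U * (V * star V) := by
        rw [hWf]; simp only [mul_assoc]
    _ = _ := by rw [hV', mul_one]

theorem mpow_spec_real (hU : star U * U = 1) {a : ι → ℝ} (ha : ∀ i, 0 ≤ a i) (w : ℝ) :
    mpow (spec U a) (w : ℂ) = spec U (fun i => if a i = 0 then 0 else a i ^ w) := by
  rw [mpow_spec hU, spec]
  congr 3
  ext i
  split_ifs
  · simp
  · rw [Complex.ofReal_cpow (ha i)]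

theorem Qsand_spec (hU : star U * U = 1) {p s : ι → ℝ} (hp : ∀ i, 0 ≤ p i) (hs : ∀ i, 0 ≤ s i)
    {α : ℝ} (hα : 1 < α) :
    Qsand α (spec U p) (spec U s) = ∑ i, p i ^ α * s i ^ (1 - α) := by
  have hα0 : α ≠ 0 := by linarith
  rw [Qsand, mpow_spec_real hU hs, spec_mul_spec hU, spec_mul_spec hU, mpow_spec_real hU,
    rtr_spec hU]
  · refine Finset.sum_congr rfl fun i _ => ?_
    by_cases h : s i = 0
    · simp [h, Real.zero_rpow (show 1 - α ≠ 0 by linarith)]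
    by_cases h' : p i = 0
    · simp [h', Real.zero_rpow hα0]
    have hsi := lt_of_le_of_ne (hs i) (Ne.symm h)
    have hpi := lt_of_le_of_ne (hp i) (Ne.symm h')
    have h1 : 0 < s i ^ ((1 - α) / (2 * α)) := Real.rpow_pos_of_pos hsi _
    rw [if_neg h, if_neg (by positivity), Real.mul_rpow (by positivity) h1.le,
      Real.mul_rpow h1.le hpi.le, mul_comm (_ ^ α) (p i ^ α), mul_assoc, ← Real.rpow_mul hsi.le,
      ← Real.rpow_add hsi]
    congr 2
    field_simp
    ring
  · intro i
    split_ifs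
    · simp
    · have := Real.rpow_nonneg (hs i) ((1 - α) / (2 * α))
      have := hp i
      positivity

theorem msupp_spec_le_iff (hU : star U * U = 1) (p s : ι → ℝ) :
    msupp (spec U p) ≤ msupp (spec U s) ↔ ∀ i, s i = 0 → p i = 0 := by
  have hU' : U * star U = 1 := mul_eq_one_comm.1 hU
  constructor
  · intro h i hi
    have hmem : (spec U p).mulVec (U.mulVec (Pi.single i 1)) ∈ msupp (spec U s) :=
      h ⟨_, rfl⟩
    obtain ⟨v, hv⟩ := hmem
    have hv' := congrArg (fun u => (star U).mulVec u i) hv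
    simp only [Matrix.mulVecLin_apply, Matrix.mulVec_mulVec] at hv'
    have e1 : star U * (spec U p * U) = Matrix.diagonal (fun i => (p i : ℂ)) := by
      rw [← mul_assoc]; exact spec_apply_conj hU p
    have e2 : star U * spec U s = Matrix.diagonal (fun i => (s i : ℂ)) * star U := by
      rw [spec, ← mul_assoc, ← mul_assoc, hU, one_mul]
    rw [e1, e2, ← Matrix.mulVec_mulVec, Matrix.mulVec_diagonal, Matrix.mulVec_diagonal, hi] at hv'
    simpa using hv'.symm
  · intro h
    rintro _ ⟨v, rfl⟩
    refine ⟨(spec U (fun i => p i / s i)).mulVec v, ?_⟩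
    simp only [Matrix.mulVecLin_apply, Matrix.mulVec_mulVec]
    rw [spec_mul_spec hU]
    congr 2
    ext i
    by_cases hi : s i = 0
    · simp [hi, h i hi]
    · field_simp

theorem Dsand_spec (hU : star U * U = 1) {p s : ι → ℝ} (hp : ∀ i, 0 ≤ p i) (hs : ∀ i, 0 ≤ s i)
    {α : ℝ} (hα : 1 < α) :
    Dsand α (spec U p) (spec U s) = if ∀ i, s i = 0 → p i = 0 then
      (((α - 1)⁻¹ * Real.log (∑ i, p i ^ α * s i ^ (1 - α)) : ℝ) : EReal) else ⊤ := by
  rw [Dsand, msupp_spec_le_iff hU, Qsand_spec hU hp hs hα]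
  simp [hα.not_gt]

theorem rtr_mul_nonneg {A B : Matrix ι ι ℂ} (hA : A.PosSemidef) (hB : B.PosSemidef) :
    0 ≤ rtr (A * B) := by
  obtain ⟨U, hU, -, h⟩ := exists_common_eigenbasis {A} (by simpa using hA.1) (by simp)
  obtain ⟨a, rfl⟩ := h A rfl
  rw [rtr_spec_mul]
  refine Finset.sum_nonneg fun i _ => mul_nonneg (nonneg_of_spec_posSemidef hU hA i) ?_
  exact (Complex.le_def.1 ((hB.conjTranspose_mul_mul_same U).diag_nonneg (i := i))).1

end Diagonalization

section TensorPowers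

variable {d : ℕ}

theorem tpow_mul (A B : Matrix (Fin d) (Fin d) ℂ) (n : ℕ) :
    tpow (A * B) n = tpow A n * tpow B n := by
  ext x y
  simp only [tpow, Matrix.of_apply, Matrix.mul_apply, Finset.prod_univ_sum,
    Fintype.piFinset_univ, Finset.prod_mul_distrib]

theorem tpow_star (A : Matrix (Fin d) (Fin d) ℂ) (n : ℕ) : tpow (star A) n = star (tpow A n) := by
  ext x y
  simp [tpow, Matrix.star_apply]

theorem tpow_diagonal (a : Fin d → ℂ) (n : ℕ) :
    tpow (Matrix.diagonal a) n = Matrix.diagonal (fun x => ∏ i, a (x i)) := by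
  ext x y
  simp only [tpow, Matrix.of_apply]
  by_cases h : x = y
  · subst h; simp
  · obtain ⟨i, hi⟩ := Function.ne_iff.1 h
    rw [Matrix.diagonal_apply_ne _ h]
    exact Finset.prod_eq_zero (Finset.mem_univ i) (Matrix.diagonal_apply_ne _ hi)

theorem tpow_one (n : ℕ) : tpow (1 : Matrix (Fin d) (Fin d) ℂ) n = 1 := by
  rw [← Matrix.diagonal_one, tpow_diagonal]
  simp

theorem tpow_unitary {U : Matrix (Fin d) (Fin d) ℂ} (hU : star U * U = 1) (n : ℕ) :
    star (tpow U n) * tpow U n = 1 := by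
  rw [← tpow_star, ← tpow_mul, hU, tpow_one]

theorem tpow_spec (U : Matrix (Fin d) (Fin d) ℂ) (a : Fin d → ℝ) (n : ℕ) :
    tpow (spec U a) n = spec (tpow U n) (fun x => ∏ i, a (x i)) := by
  simp only [spec, tpow_mul, tpow_diagonal, tpow_star, Complex.ofReal_prod]

theorem tensOp_tpow (A : Matrix (Fin d) (Fin d) ℂ) (m n : ℕ) :
    tensOp (tpow A m) (tpow A n) = tpow A (m + n) := by
  ext x y
  simp [tensOp, tpow, Fin.prod_univ_add]

/-- The operator on `H` corresponding to an operator on `H^{⊗1}`. -/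
def ofTpowOne (M : Matrix (Fin 1 → Fin d) (Fin 1 → Fin d) ℂ) : Matrix (Fin d) (Fin d) ℂ :=
  Matrix.of fun i j => M (fun _ => i) (fun _ => j)

theorem tpow_ofTpowOne (M : Matrix (Fin 1 → Fin d) (Fin 1 → Fin d) ℂ) :
    tpow (ofTpowOne M) 1 = M := by
  ext x y
  have h : ∀ z : Fin 1 → Fin d, (fun _ => z 0) = z := fun z => by
    ext i; rw [Subsingleton.elim i 0]
  simp [tpow, ofTpowOne, h]

theorem ofTpowOne_tpow (A : Matrix (Fin d) (Fin d) ℂ) : ofTpowOne (tpow A 1) = A := by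
  ext x y
  simp [tpow, ofTpowOne]

theorem tpow_one_injective {A B : Matrix (Fin d) (Fin d) ℂ} (h : tpow A 1 = tpow B 1) : A = B := by
  rw [← ofTpowOne_tpow A, h, ofTpowOne_tpow]

theorem tpow_isHermitian {A : Matrix (Fin d) (Fin d) ℂ} (hA : A.IsHermitian) (n : ℕ) :
    (tpow A n).IsHermitian := by
  have := tpow_star A n
  rw [show star A = A from hA] at this
  exact this.symm

variable {S : (n : ℕ) → Set (Matrix (Fin n → Fin d) (Fin n → Fin d) ℂ)}

theorem Assumption1.tpow_mem (hS : Assumption1 S) {σ : Matrix (Fin d) (Fin d) ℂ}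
    (hσ : tpow σ 1 ∈ S 1) {n : ℕ} (hn : 1 ≤ n) : tpow σ n ∈ S n := by
  induction n, hn using Nat.le_induction with
  | base => exact hσ
  | succ n hn ih =>
    rw [← tensOp_tpow]
    exact hS.tens n 1 hn le_rfl _ ih _ hσ

theorem Assumption1.tpow_mem_polar (hS : Assumption1 S) {X : Matrix (Fin d) (Fin d) ℂ}
    (hX : tpow X 1 ∈ polar (S 1)) {n : ℕ} (hn : 1 ≤ n) : tpow X n ∈ polar (S n) := by
  induction n, hn using Nat.le_induction with
  | base => exact hX
  | succ n hn ih =>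
    rw [← tensOp_tpow]
    exact hS.polarTens n 1 hn le_rfl _ ih _ hX

/-- The operators in `S 1` together with `ρ` are diagonal in a common basis. -/
theorem exists_eigenbasis (hS : Assumption1 S) {ρ : Matrix (Fin d) (Fin d) ℂ}
    (hρ : ρ.IsHermitian) (hcommS : ∀ A ∈ S 1, ∀ B ∈ S 1, A * B = B * A)
    (hcommρ : ∀ A ∈ S 1, A * tpow ρ 1 = tpow ρ 1 * A) :
    ∃ U : Matrix (Fin d) (Fin d) ℂ, star U * U = 1 ∧ (∃ p : Fin d → ℝ, ρ = spec U p) ∧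
      ∀ A ∈ S 1, ∃ a : Fin d → ℝ, A = tpow (spec U a) 1 := by
  obtain ⟨V, hV, -, hd⟩ := exists_common_eigenbasis (insert (tpow ρ 1) (S 1))
    (by
      rintro A (rfl | hA)
      · exact tpow_isHermitian hρ 1
      · exact (hS.psd 1 le_rfl A hA).1)
    (by
      rintro A (rfl | hA) B (rfl | hB)
      · rfl
      · exact (hcommρ B hB).symm
      · exact hcommρ A hA
      · exact hcommS A hA B hB)
  have hspec : ∀ a, spec V a = tpow (spec (ofTpowOne V) fun i => a fun _ => i) 1 := by
    intro a
    rw [tpow_spec, tpow_ofTpowOne]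
    congr 1
    ext x
    simp only [Finset.univ_unique, Finset.prod_singleton]
    congr 1
    ext i
    rw [Subsingleton.elim i default]
  refine ⟨ofTpowOne V, ?_, ?_, ?_⟩
  · apply tpow_one_injective
    rw [tpow_mul, tpow_star, tpow_ofTpowOne, hV, tpow_one]
  · obtain ⟨p, hp⟩ := hd _ (mem_insert _ _)
    exact ⟨_, tpow_one_injective (hp.trans (hspec p))⟩
  · intro A hA
    obtain ⟨a, ha⟩ := hd _ (mem_insert_of_mem _ hA)
    exact ⟨_, ha.trans (hspec a)⟩

end TensorPowers

section ProductWeights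

variable {ι : Type*} [Fintype ι]

theorem sum_prod_pow (f : ι → ℝ) (n : ℕ) :
    ∑ x : Fin n → ι, ∏ k, f (x k) = (∑ i, f i) ^ n := by
  simp only [Fintype.sum_pow]

theorem sum_fin_succ (n : ℕ) (F : (Fin (n + 1) → ι) → ℝ) :
    ∑ x, F x = ∑ i, ∑ x : Fin n → ι, F (Fin.cons i x) := by
  rw [← (Fin.consEquiv fun _ => ι).sum_comp, Fintype.sum_prod_type]
  rfl

/-- The mean of a sum of independent identically distributed variables. -/
theorem sum_prod_mul_sum {q : ι → ℝ} (hq : ∑ i, q i = 1) (f : ι → ℝ) (n : ℕ) :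
    ∑ x : Fin n → ι, (∏ k, q (x k)) * ∑ k, f (x k) = n * ∑ i, q i * f i := by
  induction n with
  | zero => simp
  | succ n ih =>
    rw [sum_fin_succ]
    simp only [Fin.prod_univ_succ, Fin.sum_univ_succ, Fin.cons_zero, Fin.cons_succ]
    have h : ∀ i, ∑ x : Fin n → ι, q i * (∏ k, q (x k)) * (f i + ∑ k, f (x k)) =
        q i * f i + q i * (n * ∑ i, q i * f i) := by
      intro i
      rw [← ih, Finset.mul_sum]
      have h1 : q i * f i = ∑ x : Fin n → ι, q i * f i * ∏ k, q (x k) := by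
        rw [← Finset.mul_sum, sum_prod_pow, hq, one_pow, mul_one]
      rw [h1, ← Finset.sum_add_distrib]
      exact Finset.sum_congr rfl fun x _ => by ring
    simp only [h, Finset.sum_add_distrib, ← Finset.sum_mul, hq]
    push_cast
    ring

/-- The variance of a sum of centered independent identically distributed variables. -/
theorem sum_prod_mul_sum_sq {q : ι → ℝ} (hq : ∑ i, q i = 1) {f : ι → ℝ}
    (hf : ∑ i, q i * f i = 0) (n : ℕ) :
    ∑ x : Fin n → ι, (∏ k, q (x k)) * (∑ k, f (x k)) ^ 2 = n * ∑ i, q i * f i ^ 2 := by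
  induction n with
  | zero => simp
  | succ n ih =>
    rw [sum_fin_succ]
    simp only [Fin.prod_univ_succ, Fin.sum_univ_succ, Fin.cons_zero, Fin.cons_succ]
    have h : ∀ i, ∑ x : Fin n → ι, q i * (∏ k, q (x k)) * (f i + ∑ k, f (x k)) ^ 2 =
        q i * f i ^ 2 + q i * (n * ∑ i, q i * f i ^ 2) := by
      intro i
      have h1 : q i * f i ^ 2 = ∑ x : Fin n → ι, q i * f i ^ 2 * ∏ k, q (x k) := by
        rw [← Finset.mul_sum, sum_prod_pow, hq, one_pow, mul_one]
      have h2 : 0 = ∑ x : Fin n → ι, 2 * q i * f i * ((∏ k, q (x k)) * ∑ k, f (x k)) := by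
        rw [← Finset.mul_sum, sum_prod_mul_sum hq, hf]; ring
      rw [← ih, Finset.mul_sum, h1, ← add_zero (∑ x : Fin n → ι, q i * f i ^ 2 * ∏ k, q (x k)),
        h2, ← Finset.sum_add_distrib, ← Finset.sum_add_distrib]
      exact Finset.sum_congr rfl fun x _ => by ring
    simp only [h, Finset.sum_add_distrib, ← Finset.sum_mul, hq]
    push_cast
    ring

theorem sum_prod_mul_abs_le {q : ι → ℝ} (hq0 : ∀ i, 0 ≤ q i) (hq : ∑ i, q i = 1) {f : ι → ℝ}
    (hf : ∑ i, q i * f i = 0) (n : ℕ) :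
    ∑ x : Fin n → ι, (∏ k, q (x k)) * |∑ k, f (x k)| ≤ √(n * ∑ i, q i * f i ^ 2) := by
  have hw : ∀ x : Fin n → ι, 0 ≤ ∏ k, q (x k) := fun x => Finset.prod_nonneg fun k _ => hq0 _
  apply Real.le_sqrt_of_sq_le
  rw [← sum_prod_mul_sum_sq hq hf]
  have hcs := Finset.sum_mul_sq_le_sq_mul_sq Finset.univ (fun x : Fin n → ι => √(∏ k, q (x k)))
    (fun x => √(∏ k, q (x k)) * |∑ k, f (x k)|)
  simp only [mul_pow, Real.sq_sqrt (hw _), sum_prod_pow, hq, one_pow, one_mul, sq_abs,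
    ← mul_assoc, Real.mul_self_sqrt (hw _)] at hcs
  exact hcs

/-- Donsker–Varadhan type lower bound on the `p`-probability of success of the randomized
likelihood-ratio test with weights `X e^{-r}`. -/
theorem le_sum_prod_mul_min {p q X : ι → ℝ} (hp : ∀ i, 0 ≤ p i) (hq0 : ∀ i, 0 ≤ q i)
    (hq : ∑ i, q i = 1) (hX : ∀ i, 0 ≤ X i) (hqp : ∀ i, q i ≠ 0 → 0 < p i ∧ 0 < X i) (r : ℝ) :
    ∃ C : ℝ, ∀ n : ℕ,
      Real.exp (-(n * (∑ i, q i * (Real.log (q i) - Real.log (p i)) +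
        max 0 (r - ∑ i, q i * Real.log (X i))) + C * √n)) ≤
      ∑ x : Fin n → ι, min 1 (∏ k, X (x k) * Real.exp (-r)) * ∏ k, p (x k) := by
  set μ := ∑ i, q i * Real.log (X i) with hμ
  set D := ∑ i, q i * (Real.log (q i) - Real.log (p i)) with hD
  let z : ι → ℝ := fun i => Real.log (X i) - r
  let f : ι → ℝ := fun i => Real.log (X i) - μ
  have hf : ∑ i, q i * f i = 0 := by
    simp only [f, mul_sub, Finset.sum_sub_distrib, ← Finset.sum_mul, hq, ← hμ]; ring
  refine ⟨√(∑ i, q i * f i ^ 2), fun n => ?_⟩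
  have hw : ∀ x : Fin n → ι, 0 ≤ ∏ k, q (x k) := fun x => Finset.prod_nonneg fun k _ => hq0 _
  let g : (Fin n → ι) → ℝ := fun x =>
    ∑ k, -(Real.log (q (x k)) - Real.log (p (x k))) + min 0 (∑ k, z (x k))
  have hjen := convexOn_exp.map_sum_le (t := Finset.univ) (w := fun x : Fin n → ι => ∏ k, q (x k))
    (p := g) (fun x _ => hw x) (by rw [sum_prod_pow, hq, one_pow]) (fun _ _ => mem_univ _)
  simp only [smul_eq_mul] at hjen
  have hlow : -(n * (D + max 0 (r - μ)) + √(∑ i, q i * f i ^ 2) * √n) ≤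
      ∑ x : Fin n → ι, (∏ k, q (x k)) * g x := by
    have habs := sum_prod_mul_abs_le hq0 hq hf n
    rw [Real.sqrt_mul (Nat.cast_nonneg n)] at habs
    have hpt : ∀ x : Fin n → ι, -(n * max 0 (r - μ)) - |∑ k, f (x k)| ≤
        min 0 (∑ k, z (x k)) := by
      intro x
      have hz : ∑ k, z (x k) = ∑ k, f (x k) - n * (r - μ) := by
        simp only [z, f, Finset.sum_sub_distrib, Finset.sum_const, Finset.card_univ,
          Fintype.card_fin, nsmul_eq_mul]
        ring
      have hn : (0 : ℝ) ≤ n := Nat.cast_nonneg n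
      refine le_min ?_ ?_
      · have := mul_nonneg hn (le_max_left 0 (r - μ))
        have := abs_nonneg (∑ k, f (x k))
        linarith
      · have := mul_le_mul_of_nonneg_left (le_max_right 0 (r - μ)) hn
        have := neg_abs_le (∑ k, f (x k))
        linarith
    have hsum : ∑ x : Fin n → ι, (∏ k, q (x k)) * g x ≥
        ∑ x : Fin n → ι, ((∏ k, q (x k)) * ∑ k, -(Real.log (q (x k)) - Real.log (p (x k))) +
          ((∏ k, q (x k)) * -(n * max 0 (r - μ)) - (∏ k, q (x k)) * |∑ k, f (x k)|)) := by
      refine Finset.sum_le_sum fun x _ => ?_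
      have := mul_le_mul_of_nonneg_left (hpt x) (hw x)
      simp only [g]
      linarith
    rw [Finset.sum_add_distrib, Finset.sum_sub_distrib, ← Finset.sum_mul, sum_prod_pow, hq,
      one_pow, sum_prod_mul_sum hq (fun i => -(Real.log (q i) - Real.log (p i)))] at hsum
    simp only [mul_neg, Finset.sum_neg_distrib, ← hD] at hsum
    linarith
  refine (Real.exp_le_exp.2 hlow).trans (hjen.trans (Finset.sum_le_sum fun x _ => ?_))
  have hmin : (0 : ℝ) ≤ min 1 (∏ k, X (x k) * Real.exp (-r)) :=
    le_min zero_le_one (Finset.prod_nonneg fun k _ => mul_nonneg (hX _) (Real.exp_pos _).le)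
  by_cases h : ∏ k, q (x k) = 0
  · rw [h, zero_mul]
    exact mul_nonneg hmin (Finset.prod_nonneg fun k _ => hp _)
  have hk : ∀ k, q (x k) ≠ 0 := fun k => Finset.prod_ne_zero_iff.1 h k (Finset.mem_univ k)
  have e1 : Real.exp (∑ k, -(Real.log (q (x k)) - Real.log (p (x k)))) =
      ∏ k, (p (x k) / q (x k)) := by
    rw [Real.exp_sum]
    refine Finset.prod_congr rfl fun k _ => ?_
    rw [neg_sub, Real.exp_sub, Real.exp_log (hqp _ (hk k)).1,
      Real.exp_log (lt_of_le_of_ne (hq0 _) (hk k).symm)]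
  have e2 : Real.exp (min 0 (∑ k, z (x k))) = min 1 (∏ k, X (x k) * Real.exp (-r)) := by
    rw [Real.exp_monotone.map_min, Real.exp_zero, Real.exp_sum]
    congr 1
    refine Finset.prod_congr rfl fun k _ => ?_
    simp only [z]
    rw [Real.exp_sub, Real.exp_log (hqp _ (hk k)).2, Real.exp_neg, div_eq_mul_inv]
  simp only [g]
  rw [Real.exp_add, e1, e2, Finset.prod_div_distrib]
  rw [← mul_assoc, mul_div_cancel₀ _ h, mul_comm]

/-- One-shot converse: a test with small type II error has small power. -/
theorem sum_mul_le_of_sum_mul_le {κ : Type*} [Fintype κ] {P W T : κ → ℝ} (hP : ∀ x, 0 ≤ P x)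
    (hW : ∀ x, 0 ≤ W x) (hT : ∀ x, 0 ≤ T x) (hT1 : ∀ x, T x ≤ 1) (hPW : ∀ x, W x = 0 → P x = 0)
    {α : ℝ} (hα : 1 < α) {A B : ℝ} (hA : 0 < A) (hB : 0 < B)
    (hAs : ∑ x, P x ^ α * W x ^ (1 - α) ≤ A) (hBs : ∑ x, W x * T x ≤ B) :
    ∑ x, P x * T x ≤ A ^ (α⁻¹) * B ^ ((α - 1) / α) := by
  have hα0 : 0 < α := by linarith
  have hs : α⁻¹ + (α - 1) / α = 1 := by field_simp; ring
  have hs0 : 0 ≤ (α - 1) / α := div_nonneg (by linarith) hα0.le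
  have hc : 0 < A ^ (α⁻¹) * B ^ ((α - 1) / α) :=
    mul_pos (Real.rpow_pos_of_pos hA _) (Real.rpow_pos_of_pos hB _)
  have hpt : ∀ x, P x * T x / (A ^ (α⁻¹) * B ^ ((α - 1) / α)) ≤
      α⁻¹ * (P x ^ α * W x ^ (1 - α) / A) + (α - 1) / α * (W x * T x / B) := by
    intro x
    have hQ : 0 ≤ P x ^ α * W x ^ (1 - α) :=
      mul_nonneg (Real.rpow_nonneg (hP x) _) (Real.rpow_nonneg (hW x) _)
    have hy := Real.geom_mean_le_arith_mean2_weighted (inv_nonneg.2 hα0.le) hs0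
      (div_nonneg hQ hA.le) (div_nonneg (hW x) hB.le) hs
    have he : (P x ^ α * W x ^ (1 - α) / A) ^ α⁻¹ * (W x / B) ^ ((α - 1) / α) =
        P x / (A ^ (α⁻¹) * B ^ ((α - 1) / α)) := by
      rcases (hW x).eq_or_lt with h0 | h0
      · rw [hPW x h0.symm, ← h0]
        simp [Real.zero_rpow hα0.ne', Real.zero_rpow (inv_ne_zero hα0.ne')]
      · rw [Real.div_rpow hQ hA.le, Real.div_rpow h0.le hB.le,
          Real.mul_rpow (Real.rpow_nonneg (hP x) _) (Real.rpow_nonneg h0.le _),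
          ← Real.rpow_mul (hP x), ← Real.rpow_mul h0.le, mul_inv_cancel₀ hα0.ne', Real.rpow_one,
          div_mul_div_comm, mul_assoc, ← Real.rpow_add h0,
          show (1 - α) * α⁻¹ + (α - 1) / α = 0 by field_simp; ring, Real.rpow_zero, mul_one]
    rw [he] at hy
    have h1 := mul_le_mul_of_nonneg_right hy (hT x)
    have h2 : α⁻¹ * (P x ^ α * W x ^ (1 - α) / A) * T x ≤ α⁻¹ * (P x ^ α * W x ^ (1 - α) / A) :=
      mul_le_of_le_one_right (mul_nonneg (inv_nonneg.2 hα0.le) (div_nonneg hQ hA.le)) (hT1 x)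
    calc P x * T x / (A ^ (α⁻¹) * B ^ ((α - 1) / α))
        = P x / (A ^ (α⁻¹) * B ^ ((α - 1) / α)) * T x := by ring
      _ ≤ _ := h1
      _ = α⁻¹ * (P x ^ α * W x ^ (1 - α) / A) * T x + (α - 1) / α * (W x * T x / B) := by ring
      _ ≤ _ := by linarith
  have hsum := Finset.sum_le_sum fun x (_ : x ∈ Finset.univ) => hpt x
  rw [Finset.sum_add_distrib, ← Finset.sum_div, ← Finset.mul_sum, ← Finset.mul_sum,
    ← Finset.sum_div, ← Finset.sum_div, div_le_iff₀ hc] at hsum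
  refine hsum.trans (mul_le_of_le_one_left hc.le ?_)
  have h1 : (∑ x, P x ^ α * W x ^ (1 - α)) / A ≤ 1 := (div_le_one hA).2 hAs
  have h2 : (∑ x, W x * T x) / B ≤ 1 := (div_le_one hB).2 hBs
  nlinarith [mul_le_mul_of_nonneg_left h1 (inv_nonneg.2 hα0.le), mul_le_mul_of_nonneg_left h2 hs0]

end ProductWeights

section Optimization

theorem deriv_nonpos_of_forall_le_right {f : ℝ → ℝ} {f' x y : ℝ} (hf : HasDerivAt f f' x)
    (hxy : x < y) (h : ∀ u ∈ Ioo x y, f u ≤ f x) : f' ≤ 0 := by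
  have ht := (hasDerivWithinAt_iff_tendsto_slope' self_notMem_Ioi).1
    (hf.hasDerivWithinAt (s := Ioi x))
  refine le_of_tendsto ht ?_
  filter_upwards [Ioo_mem_nhdsGT hxy] with u hu
  rw [slope_def_field]
  exact div_nonpos_of_nonpos_of_nonneg (by linarith [h u hu]) (by linarith [hu.1])

theorem deriv_nonneg_of_forall_le_left {f : ℝ → ℝ} {f' x y : ℝ} (hf : HasDerivAt f f' x)
    (hxy : y < x) (h : ∀ u ∈ Ioo y x, f u ≤ f x) : 0 ≤ f' := by
  have ht := (hasDerivWithinAt_iff_tendsto_slope' self_notMem_Iio).1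
    (hf.hasDerivWithinAt (s := Iio x))
  refine ge_of_tendsto ht ?_
  filter_upwards [Ioo_mem_nhdsLT hxy] with u hu
  rw [slope_def_field]
  exact div_nonneg_of_nonpos (by linarith [h u hu]) (by linarith [hu.2])

variable {ι : Type*} [Fintype ι]

/-- The partition function `∑ p^{1+t} s^{-t}`. -/
def partitionFn (p s : ι → ℝ) (t : ℝ) : ℝ :=
  ∑ i, p i * Real.exp (t * (Real.log (p i) - Real.log (s i)))

theorem partitionFn_pos {p : ι → ℝ} (hp : ∀ i, 0 ≤ p i) (hp1 : ∑ i, p i = 1) (s : ι → ℝ) (t : ℝ) :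
    0 < partitionFn p s t := by
  obtain ⟨i, hi, hpi⟩ := Finset.exists_ne_zero_of_sum_ne_zero (hp1.trans_ne one_ne_zero)
  refine Finset.sum_pos' (fun j _ => mul_nonneg (hp j) (Real.exp_pos _).le) ⟨i, hi, ?_⟩
  exact mul_pos (lt_of_le_of_ne (hp i) hpi.symm) (Real.exp_pos _)

theorem partitionFn_eq_sum_rpow {p s : ι → ℝ} (hp : ∀ i, 0 ≤ p i)
    (hs : ∀ i, p i ≠ 0 → 0 < s i) {t : ℝ} (ht : 0 < t) :
    partitionFn p s t = ∑ i, p i ^ (1 + t) * s i ^ (1 - (1 + t)) := by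
  refine Finset.sum_congr rfl fun i _ => ?_
  by_cases h : p i = 0
  · simp [h, Real.zero_rpow (show 1 + t ≠ 0 by linarith)]
  have hpi := lt_of_le_of_ne (hp i) (Ne.symm h)
  rw [Real.rpow_add hpi, Real.rpow_one, Real.rpow_def_of_pos hpi, Real.rpow_def_of_pos (hs i h),
    mul_assoc, ← Real.exp_add]
  congr 2
  ring

theorem hasDerivAt_partitionFn (p s : ι → ℝ) (t : ℝ) :
    HasDerivAt (partitionFn p s) (∑ i, p i * Real.exp (t * (Real.log (p i) - Real.log (s i))) *
      (Real.log (p i) - Real.log (s i))) t := by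
  refine HasDerivAt.fun_sum fun i _ => ?_
  have h := (((hasDerivAt_id t).mul_const (Real.log (p i) - Real.log (s i))).exp).const_mul (p i)
  exact h.congr_deriv (by simp; ring)

theorem hasDerivAt_partitionFn_line {p s : ι → ℝ} (hs : ∀ i, p i ≠ 0 → 0 < s i) (v : ι → ℝ)
    (t : ℝ) :
    HasDerivAt (fun w : ℝ => partitionFn p (fun i => s i + w * v i) t)
      (∑ i, p i * Real.exp (t * (Real.log (p i) - Real.log (s i))) * -(t * (v i / s i))) 0 := by
  refine HasDerivAt.fun_sum fun i _ => ?_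
  by_cases h : p i = 0
  · simpa [h] using hasDerivAt_const (0 : ℝ) (0 : ℝ)
  have h0 : s i + 0 * v i ≠ 0 := by simpa using (hs i h).ne'
  have h1 := (((hasDerivAt_id (0 : ℝ)).mul_const (v i)).const_add (s i)).log h0
  have h2 := (((h1.const_sub (Real.log (p i))).const_mul t).exp).const_mul (p i)
  exact h2.congr_deriv (by simp; ring)

theorem continuousOn_log_partitionFn {p : ι → ℝ} (hp : ∀ i, 0 ≤ p i) (hp1 : ∑ i, p i = 1)
    {K : Set (ι → ℝ)} {m : (ι → ℝ) → ι → ℝ} (hm : Continuous m)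
    (hK : ∀ a ∈ K, ∀ i, p i ≠ 0 → 0 < m a i) (s : Set ℝ) :
    ContinuousOn (fun x : ℝ × (ι → ℝ) => Real.log (partitionFn p (m x.2) x.1)) (s ×ˢ K) := by
  refine ContinuousOn.log ?_ fun x _ => (partitionFn_pos hp hp1 _ _).ne'
  refine continuousOn_finsetSum _ fun i _ => ?_
  by_cases h : p i = 0
  · simpa [h] using continuousOn_const
  refine continuousOn_const.mul (Real.continuous_exp.comp_continuousOn ?_)
  refine continuousOn_fst.mul (continuousOn_const.sub (ContinuousOn.log ?_ ?_))
  · exact ((continuous_apply i).comp (hm.comp continuous_snd)).continuousOn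
  · exact fun x hx => (hK x.2 hx.2 i h).ne'

theorem abs_sum_mul_log_sub_log_le {q s : ι → ℝ} (hq0 : ∀ i, 0 ≤ q i) (hq : ∑ i, q i = 1)
    {B : ℝ} (hB : ∀ i, q i ≠ 0 → |Real.log (s i)| ≤ B) :
    |∑ i, q i * (Real.log (q i) - Real.log (s i))| ≤ Fintype.card ι + B := by
  have hq1 : ∀ i, q i ≤ 1 := fun i => hq ▸
    Finset.single_le_sum (fun j _ => hq0 j) (Finset.mem_univ i)
  calc |∑ i, q i * (Real.log (q i) - Real.log (s i))|
      ≤ ∑ i, |q i * (Real.log (q i) - Real.log (s i))| := Finset.abs_sum_le_sum_abs _ _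
    _ ≤ ∑ i, (1 + q i * B) := by
        refine Finset.sum_le_sum fun i _ => ?_
        by_cases h : q i = 0
        · simp [h]
        have h1 := Real.abs_log_mul_self_lt (q i) (lt_of_le_of_ne (hq0 i) (Ne.symm h)) (hq1 i)
        have h2 : |q i * Real.log (s i)| ≤ q i * B := by
          rw [abs_mul, abs_of_nonneg (hq0 i)]
          exact mul_le_mul_of_nonneg_left (hB i h) (hq0 i)
        rw [mul_sub]
        refine (abs_sub _ _).trans ?_
        rw [mul_comm (q i) (Real.log (q i))]
        linarith
    _ = _ := by
        rw [Finset.sum_add_distrib, ← Finset.sum_mul, hq]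
        simp

/-- Near-optimal weights `X` in the polar of `K`, with a tilted distribution `q` witnessing the
exponent of the associated likelihood-ratio tests. -/
theorem exists_polar_weights {p : ι → ℝ} (hp : ∀ i, 0 ≤ p i) (hp1 : ∑ i, p i = 1)
    {K : Set (ι → ℝ)} (hKc : Convex ℝ K) (hK : IsCompact K) (hK0 : ∀ a ∈ K, ∀ i, 0 ≤ a i)
    {τ : ι → ℝ} (hτ : τ ∈ K) (hτp : ∀ i, p i ≠ 0 → 0 < τ i) {r R : ℝ}
    (hR : ∀ t > 0, ∀ s ∈ K, (∀ i, p i ≠ 0 → 0 < s i) →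
      (t * r - Real.log (partitionFn p s t)) / (1 + t) ≤ R) {ε : ℝ} (hε : 0 < ε) :
    ∃ q X : ι → ℝ, (∀ i, 0 ≤ q i) ∧ ∑ i, q i = 1 ∧ (∀ i, 0 ≤ X i) ∧
      (∀ i, q i ≠ 0 → 0 < p i ∧ 0 < X i) ∧ (∀ a ∈ K, ∑ i, X i * a i ≤ 1) ∧
      ∑ i, q i * (Real.log (q i) - Real.log (p i)) +
        max 0 (r - ∑ i, q i * Real.log (X i)) ≤ R + ε := by
  set e := Real.exp (-(ε / 2)) with he
  have he0 : 0 < e := Real.exp_pos _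
  have he1 : e < 1 := Real.exp_lt_one_iff.2 (by linarith)
  let m : (ι → ℝ) → ι → ℝ := fun a i => e * a i + (1 - e) * τ i
  have hm : Continuous m := by fun_prop
  have hmK : ∀ a ∈ K, m a ∈ K := fun a ha =>
    hKc ha hτ he0.le (by linarith) (by ring)
  have hmpos : ∀ a ∈ K, ∀ i, p i ≠ 0 → 0 < m a i := fun a ha i hi =>
    add_pos_of_nonneg_of_pos (mul_nonneg he0.le (hK0 a ha i))
      (mul_pos (by linarith) (hτp i hi))
  obtain ⟨B, hB⟩ : ∃ B : ℝ, ∀ a ∈ K, ∀ i, p i ≠ 0 → |Real.log (m a i)| ≤ B := by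
    obtain ⟨B, hB⟩ := hK.exists_bound_of_continuousOn
      (f := fun a => ∑ i ∈ Finset.univ.filter (fun i => p i ≠ 0), |Real.log (m a i)|)
      (continuousOn_finsetSum _ fun i hi => (ContinuousOn.log
        ((continuous_apply i).comp hm).continuousOn
          fun a ha => (hmpos a ha i (Finset.mem_filter.1 hi).2).ne').abs)
    refine ⟨B, fun a ha i hi => ?_⟩
    refine le_trans ?_ ((le_abs_self _).trans (hB a ha))
    exact Finset.single_le_sum (f := fun i => |Real.log (m a i)|) (fun j _ => abs_nonneg _)
      (Finset.mem_filter.2 ⟨Finset.mem_univ i, hi⟩)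
  have hB0 : 0 ≤ B := by
    obtain ⟨i, -, hpi⟩ := Finset.exists_ne_zero_of_sum_ne_zero (hp1.trans_ne one_ne_zero)
    exact (abs_nonneg _).trans (hB τ hτ i hpi)
  set C := |r| + (Fintype.card ι + B) with hC
  have hC0 : 0 ≤ C := by positivity
  obtain ⟨δ, hδ0, hδ1, hδC⟩ : ∃ δ : ℝ, 0 < δ ∧ δ < 1 ∧ C * δ ≤ ε / 2 := by
    refine ⟨min (1 / 2) (ε / 2 / (C + 1)), by positivity,
      (min_le_left _ _).trans_lt (by norm_num), ?_⟩
    calc C * min (1 / 2) (ε / 2 / (C + 1)) ≤ C * (ε / 2 / (C + 1)) :=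
          mul_le_mul_of_nonneg_left (min_le_right _ _) hC0
      _ ≤ (C + 1) * (ε / 2 / (C + 1)) :=
          mul_le_mul_of_nonneg_right (by linarith) (by positivity)
      _ = ε / 2 := by field_simp
  have hδi : δ ≤ 1 / δ := by
    rw [le_div_iff₀ hδ0]; nlinarith
  let G : ℝ × (ι → ℝ) → ℝ := fun x => (x.1 * r - Real.log (partitionFn p (m x.2) x.1)) / (1 + x.1)
  have hG : ContinuousOn G (Icc δ (1 / δ) ×ˢ K) := by
    refine ContinuousOn.div ?_ (by fun_prop) fun x hx => ?_
    · exact (by fun_prop : ContinuousOn (fun x : ℝ × (ι → ℝ) => x.1 * r) _).sub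
        (continuousOn_log_partitionFn hp hp1 hm hmpos _)
    · have := hx.1.1
      linarith
  obtain ⟨⟨t, a⟩, ⟨⟨htl, htr⟩, ha⟩, hmax⟩ := (isCompact_Icc.prod hK).exists_isMaxOn
    ⟨(δ, τ), ⟨⟨le_rfl, hδi⟩, hτ⟩⟩ hG
  change δ ≤ t at htl
  change t ≤ 1 / δ at htr
  change a ∈ K at ha
  have ht0 : 0 < t := hδ0.trans_le htl
  have h1t : 0 < 1 + t := by linarith
  set s := m a with hs
  have hspos : ∀ i, p i ≠ 0 → 0 < s i := hmpos a ha
  set y : ι → ℝ := fun i => Real.log (p i) - Real.log (s i) with hy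
  set Z := partitionFn p s t with hZ
  have hZ0 : 0 < Z := partitionFn_pos hp hp1 s t
  set q : ι → ℝ := fun i => p i * Real.exp (t * y i) / Z with hq
  have hq0 : ∀ i, 0 ≤ q i := fun i =>
    div_nonneg (mul_nonneg (hp i) (Real.exp_pos _).le) hZ0.le
  have hq1 : ∑ i, q i = 1 := by
    rw [← Finset.sum_div]; exact div_self hZ0.ne'
  have hqp : ∀ i, q i ≠ 0 → p i ≠ 0 := fun i hi h => hi (by simp [hq, h])
  have hppos : ∀ i, q i ≠ 0 → 0 < p i := fun i hi => lt_of_le_of_ne (hp i) (hqp i hi).symm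
  have hlogq : ∀ i, q i ≠ 0 → Real.log (q i) = Real.log (p i) + t * y i - Real.log Z := by
    intro i hi
    rw [hq, Real.log_div (mul_ne_zero (hqp i hi) (Real.exp_pos _).ne') hZ0.ne',
      Real.log_mul (hqp i hi) (Real.exp_pos _).ne', Real.log_exp]
  let X : ι → ℝ := fun i => e * (q i / s i)
  have hs0 : ∀ i, 0 ≤ s i := hK0 _ (hmK a ha)
  set D1 := ∑ i, q i * y i with hD1
  have hsum : ∀ (f : ι → ℝ) (b c : ℝ), (∀ i, q i ≠ 0 → f i = b * y i + c) →
      ∑ i, q i * f i = b * D1 + c := by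
    intro f b c hf
    have : ∀ i, q i * f i = b * (q i * y i) + c * q i := by
      intro i
      by_cases h : q i = 0
      · simp [h]
      · rw [hf i h]; ring
    rw [Finset.sum_congr rfl fun i _ => this i, Finset.sum_add_distrib, ← Finset.mul_sum,
      ← Finset.mul_sum, hq1, mul_one]
  have hDp : ∑ i, q i * (Real.log (q i) - Real.log (p i)) = t * D1 + -Real.log Z :=
    hsum _ _ _ fun i hi => by rw [hlogq i hi]; ring
  have hDs : ∑ i, q i * (Real.log (q i) - Real.log (s i)) = (1 + t) * D1 + -Real.log Z :=
    hsum _ _ _ fun i hi => by rw [hlogq i hi, hy]; ring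
  have hDX : ∑ i, q i * Real.log (X i) = (1 + t) * D1 + (-Real.log Z - ε / 2) :=
    hsum _ _ _ fun i hi => by
      rw [Real.log_mul he0.ne' (div_ne_zero hi (hspos i (hqp i hi)).ne'),
        Real.log_div hi (hspos i (hqp i hi)).ne', he, Real.log_exp, hlogq i hi, hy]
      ring
  set u := r - ((1 + t) * D1 - Real.log Z) with hu
  have huC : |u| ≤ C := by
    have h := abs_sum_mul_log_sub_log_le (s := s) hq0 hq1 fun i hi => hB a ha i (hqp i hi)
    rw [hDs, ← sub_eq_add_neg] at h
    exact (abs_sub _ _).trans (by rw [hC]; linarith)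
  have hGR : (t * r - Real.log Z) / (1 + t) ≤ R := hR t ht0 s (hmK a ha) hspos
  have hdG : HasDerivAt (fun t' => G (t', a)) (u / (1 + t) ^ 2) t := by
    have h1 := (hasDerivAt_partitionFn p s t).log hZ0.ne'
    have h2 := (((hasDerivAt_id t).mul_const r).sub h1).div
      ((hasDerivAt_id t).const_add 1) h1t.ne'
    refine h2.congr_deriv ?_
    have : D1 = (∑ i, p i * Real.exp (t * (Real.log (p i) - Real.log (s i))) *
        (Real.log (p i) - Real.log (s i))) / Z := by
      rw [hD1, Finset.sum_div]
      exact Finset.sum_congr rfl fun i _ => by simp only [hq, hy]; ring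
    simp only [id, ← hZ, Pi.sub_apply]
    rw [← this, hu]
    ring
  refine ⟨q, X, hq0, hq1, fun i => mul_nonneg he0.le (div_nonneg (hq0 i) (hs0 i)),
    fun i hi => ⟨hppos i hi, mul_pos he0
      (div_pos (lt_of_le_of_ne (hq0 i) hi.symm) (hspos i (hqp i hi)))⟩, ?_, ?_⟩
  · intro a' ha'
    have hline : ∀ w ∈ Ioo (0 : ℝ) 1, -partitionFn p (fun i => s i + w * (e * (a' i - a i))) t ≤
        -partitionFn p (fun i => s i + 0 * (e * (a' i - a i))) t := by
      intro w hw
      have hmem : (1 - w) • a + w • a' ∈ K :=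
        hKc ha ha' (by linarith [hw.2]) hw.1.le (by ring)
      have h : G (t, (1 - w) • a + w • a') ≤ G (t, a) := hmax ⟨⟨htl, htr⟩, hmem⟩
      have hmw : m ((1 - w) • a + w • a') = fun i => s i + w * (e * (a' i - a i)) := by
        ext i
        simp only [m, hs, Pi.add_apply, Pi.smul_apply, smul_eq_mul]
        ring
      have h' := (div_le_div_iff_of_pos_right h1t).1 h
      simp only [hmw] at h'
      have hlog := (sub_le_sub_iff_left _).1 h'
      have := (Real.log_le_log_iff hZ0 (partitionFn_pos hp hp1 _ _)).1 hlog
      simpa using this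
    have hneg := deriv_nonpos_of_forall_le_right
      (hasDerivAt_partitionFn_line hspos (fun i => e * (a' i - a i)) t).neg zero_lt_one hline
    have hXeq : -∑ i, p i * Real.exp (t * (Real.log (p i) - Real.log (s i))) *
        -(t * (e * (a' i - a i) / s i)) = t * Z * (∑ i, X i * a' i - ∑ i, X i * a i) := by
      rw [← Finset.sum_sub_distrib, Finset.mul_sum, ← Finset.sum_neg_distrib]
      refine Finset.sum_congr rfl fun i _ => ?_
      simp only [X, hq, hy]
      field_simp
    rw [hXeq] at hneg
    have hle : ∑ i, X i * a' i - ∑ i, X i * a i ≤ 0 := by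
      by_contra hcon
      push Not at hcon
      exact absurd hneg (not_le.2 (mul_pos (mul_pos ht0 hZ0) hcon))
    have ha1 : ∑ i, X i * a i ≤ ∑ i, q i := by
      refine Finset.sum_le_sum fun i _ => ?_
      by_cases h : q i = 0
      · simp [X, h]
      have hsi := hspos i (hqp i h)
      have hea : e * a i ≤ s i :=
        le_add_of_nonneg_right (mul_nonneg (by linarith) (hK0 τ hτ i))
      calc X i * a i = q i * (e * a i / s i) := by simp only [X]; ring
        _ ≤ q i * 1 := mul_le_mul_of_nonneg_left ((div_le_one hsi).2 hea) (hq0 i)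
        _ = q i := mul_one _
    linarith
  · rw [hDp, hDX]
    have hmain : t * D1 + -Real.log Z + max 0 u ≤ R + ε / 2 := by
      have hkey : t * D1 + -Real.log Z = (t * r - Real.log Z) / (1 + t) - t / (1 + t) * u := by
        rw [hu]; field_simp; ring
      rcases lt_trichotomy u 0 with h | h | h
      · have htδ : t = δ := by
          by_contra hne
          have hlt : δ < t := lt_of_le_of_ne htl (Ne.symm hne)
          have := deriv_nonneg_of_forall_le_left hdG hlt fun t' ht' =>
            hmax (show (t', a) ∈ _ from ⟨⟨ht'.1.le, ht'.2.le.trans htr⟩, ha⟩)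
          exact absurd this (not_le.2 (div_neg_of_neg_of_pos h (by positivity)))
        rw [max_eq_left h.le, hkey]
        have h1 : t / (1 + t) ≤ δ := by
          rw [div_le_iff₀ h1t, htδ]; nlinarith
        have h2 : t / (1 + t) * -u ≤ δ * C :=
          mul_le_mul h1 ((neg_le_abs u).trans huC) (by linarith) hδ0.le
        linarith
      · rw [hkey, h]; simp; linarith
      · have htδ : t = 1 / δ := by
          by_contra hne
          have hlt : t < 1 / δ := lt_of_le_of_ne htr hne
          have := deriv_nonpos_of_forall_le_right hdG hlt fun t' ht' =>
            hmax (show (t', a) ∈ _ from ⟨⟨htl.trans ht'.1.le, ht'.2.le⟩, ha⟩)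
          exact absurd this (not_le.2 (div_pos h (by positivity)))
        rw [max_eq_right h.le, hkey]
        have h1 : 1 / (1 + t) ≤ δ := by
          rw [div_le_iff₀ h1t, htδ]; field_simp; linarith
        have h2 : 1 / (1 + t) * u ≤ δ * C :=
          mul_le_mul h1 ((le_abs_self u).trans huC) h.le hδ0.le
        have h3 : u - t / (1 + t) * u = 1 / (1 + t) * u := by field_simp; ring
        linarith
    have hmx : max 0 (r - ((1 + t) * D1 + (-Real.log Z - ε / 2))) ≤ max 0 u + ε / 2 := by
      refine max_le (by positivity) ?_
      have := le_max_right 0 u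
      linarith
    linarith

end Optimization

section Rates

theorem coe_le_rate_iff {n : ℕ} (hn : 1 ≤ n) {c x : ℝ} :
    (c : EReal) ≤ rate n x ↔ x ≤ Real.exp (-(n * c)) := by
  have hn0 : (0 : ℝ) < n := by exact_mod_cast hn
  by_cases hx : x ≤ 0
  · simp [rate, negLog, hx, EReal.coe_mul_top_of_pos (inv_pos.2 hn0), hx.trans (Real.exp_pos _).le]
  · rw [rate, negLog, if_neg hx, ← EReal.coe_mul, EReal.coe_le_coe_iff,
      ← Real.log_le_iff_le_exp (not_le.1 hx), inv_mul_eq_div, le_div_iff₀ hn0]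
    constructor <;> intro h <;> linarith

theorem rate_le_coe_iff {n : ℕ} (hn : 1 ≤ n) {c x : ℝ} :
    rate n x ≤ (c : EReal) ↔ Real.exp (-(n * c)) ≤ x := by
  have hn0 : (0 : ℝ) < n := by exact_mod_cast hn
  by_cases hx : x ≤ 0
  · simp [rate, negLog, hx, EReal.coe_mul_top_of_pos (inv_pos.2 hn0),
      hx.trans_lt (Real.exp_pos _)]
  · rw [rate, negLog, if_neg hx, ← EReal.coe_mul, EReal.coe_le_coe_iff,
      ← Real.le_log_iff_exp_le (not_le.1 hx), inv_mul_eq_div, div_le_iff₀ hn0]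
    constructor <;> intro h <;> linarith

/-- The limiting term at `α = ∞` is controlled by the terms at finite `α`. -/
theorem sub_limsup_le {f : ℝ → EReal}
    (hf : (∀ α > 1, f α = ⊤) ∨ ∀ α > 1, ∃ x : ℝ, f α = x) {r : ℝ} {s : EReal} (hs0 : 0 ≤ s)
    (hs : ∀ α > 1, (((α - 1) / α : ℝ) : EReal) * ((r : EReal) - f α) ≤ s) :
    (r : EReal) - limsup f atTop ≤ s := by
  rcases hf with hf | hf
  · have : limsup f atTop = ⊤ := by
      rw [limsup_congr ((eventually_gt_atTop 1).mono hf), limsup_const]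
    simp [this]
  induction s with
  | bot => simp at hs0
  | top => exact le_top
  | coe c =>
    have ht : Tendsto (fun α : ℝ => ((r - c * (1 + (α - 1)⁻¹) : ℝ) : EReal)) atTop
        (nhds ((r - c : ℝ) : EReal)) := by
      refine continuous_coe_real_ereal.continuousAt.tendsto.comp ?_
      have h1 : Tendsto (fun α : ℝ => (α - 1)⁻¹) atTop (nhds 0) :=
        tendsto_inv_atTop_zero.comp (tendsto_atTop_add_const_right _ (-1) tendsto_id)
      simpa using tendsto_const_nhds.sub ((h1.const_add 1).const_mul c)
    have hle : ((r - c : ℝ) : EReal) ≤ limsup f atTop := by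
      rw [← ht.limsup_eq]
      refine limsup_le_limsup ((eventually_gt_atTop 1).mono fun α hα => ?_)
      obtain ⟨x, hx⟩ := hf α hα
      have h := hs α hα
      rw [hx, ← EReal.coe_sub, ← EReal.coe_mul, EReal.coe_le_coe_iff] at h
      rw [hx, EReal.coe_le_coe_iff]
      have hα1 : 0 < α - 1 := sub_pos.2 hα
      have hα0 : 0 < α := by linarith
      have h2 : r - x ≤ c * (α / (α - 1)) := by
        rw [div_mul_eq_mul_div, div_le_iff₀ hα0] at h
        rw [mul_div_assoc', le_div_iff₀ hα1]
        linarith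
      have h3 : 1 + (α - 1)⁻¹ = α / (α - 1) := by field_simp; ring
      rw [h3]
      linarith
    calc (r : EReal) - limsup f atTop ≤ r - ((r - c : ℝ) : EReal) := EReal.sub_le_sub le_rfl hle
      _ = c := by rw [← EReal.coe_sub]; congr 1; ring

end Rates

section Spectral

variable {ι : Type*} [Fintype ι]

theorem rtr_sub (A B : Matrix ι ι ℂ) : rtr (A - B) = rtr A - rtr B := by
  simp [rtr]

theorem rtr_mul_comm (A B : Matrix ι ι ℂ) : rtr (A * B) = rtr (B * A) := by
  rw [rtr, Matrix.trace_mul_comm, rtr]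

theorem rtr_smul_mul (c : ℝ) (A B : Matrix ι ι ℂ) :
    rtr (((c : ℂ) • A) * B) = c * rtr (A * B) := by
  simp [rtr]

variable [DecidableEq ι] {U : Matrix ι ι ℂ}

theorem spec_sub (a b : ι → ℝ) : spec U a - spec U b = spec U (fun i => a i - b i) := by
  rw [spec, spec, spec, ← sub_mul, ← mul_sub, Matrix.diagonal_sub]
  simp only [Complex.ofReal_sub]

theorem spec_smul (c : ℝ) (a : ι → ℝ) : (c : ℂ) • spec U a = spec U (fun i => c * a i) := by
  rw [spec, spec, ← smul_mul_assoc, ← mul_smul_comm, ← Matrix.diagonal_smul]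
  congr 3
  ext i
  simp

theorem spec_one (hU : star U * U = 1) : spec U (fun _ => 1) = 1 := by
  simp [spec, mul_eq_one_comm.1 hU]

theorem isTest_spec (hU : star U * U = 1) {a : ι → ℝ} (h0 : ∀ i, 0 ≤ a i) (h1 : ∀ i, a i ≤ 1) :
    IsTest (spec U a) := by
  refine ⟨spec_posSemidef h0, ?_⟩
  rw [← spec_one hU, spec_sub]
  exact spec_posSemidef fun i => sub_nonneg.2 (h1 i)

theorem IsTest.diag_mem_Icc {T : Matrix ι ι ℂ} (hT : IsTest T) (hU : star U * U = 1) (i : ι) :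
    ((star U * T * U) i i).re ∈ Icc (0 : ℝ) 1 := by
  have h0 := (Complex.le_def.1 ((hT.1.conjTranspose_mul_mul_same U).diag_nonneg (i := i))).1
  have h1 := (Complex.le_def.1 ((hT.2.conjTranspose_mul_mul_same U).diag_nonneg (i := i))).1
  rw [← Matrix.star_eq_conjTranspose] at h0 h1
  rw [mul_sub, sub_mul, mul_one, hU] at h1
  simp only [Matrix.sub_apply, Matrix.one_apply_eq, Complex.sub_re, Complex.zero_re,
    Complex.one_re] at h0 h1
  exact ⟨h0, by linarith⟩

end Spectral

section Testing

variable {d : ℕ} {U : Matrix (Fin d) (Fin d) ℂ}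

theorem trace_tpow (ρ : Matrix (Fin d) (Fin d) ℂ) (n : ℕ) : (tpow ρ n).trace = ρ.trace ^ n := by
  simp only [Matrix.trace, Matrix.diag_apply, tpow, Matrix.of_apply, Fintype.sum_pow]

theorem one_sub_typeI {ρ : Matrix (Fin d) (Fin d) ℂ} (hρ : ρ.trace = 1) {n : ℕ}
    (T : Matrix (Fin n → Fin d) (Fin n → Fin d) ℂ) : 1 - typeI ρ n T = rtr (tpow ρ n * T) := by
  have : rtr (tpow ρ n) = 1 := by simp [rtr, trace_tpow, hρ]
  rw [typeI, sub_mul, one_mul, rtr_sub, this, rtr_mul_comm T, sub_sub_cancel]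

theorem rtr_mul_le_typeII {n : ℕ} {S : Set (Matrix (Fin n → Fin d) (Fin n → Fin d) ℂ)}
    (hS : IsCompact S) {σ : Matrix (Fin n → Fin d) (Fin n → Fin d) ℂ} (hσ : σ ∈ S)
    (T : Matrix (Fin n → Fin d) (Fin n → Fin d) ℂ) : rtr (σ * T) ≤ typeII S T := by
  refine le_csSup (hS.bddAbove_image (Continuous.continuousOn ?_)) (mem_image_of_mem _ hσ)
  exact Complex.continuous_re.comp ((continuous_id.matrix_mul continuous_const).matrix_trace)

theorem Dsand_tpow_one (hU : star U * U = 1) {p s : Fin d → ℝ} (hp : ∀ i, 0 ≤ p i)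
    (hs : ∀ i, 0 ≤ s i) {α : ℝ} (hα : 1 < α) :
    Dsand α (tpow (spec U p) 1) (tpow (spec U s) 1) = if ∀ i, s i = 0 → p i = 0 then
      (((α - 1)⁻¹ * Real.log (∑ i, p i ^ α * s i ^ (1 - α)) : ℝ) : EReal) else ⊤ := by
  have hsum : ∑ x : Fin 1 → Fin d, p (x 0) ^ α * s (x 0) ^ (1 - α) =
      ∑ i, p i ^ α * s i ^ (1 - α) :=
    Fintype.sum_equiv (Equiv.funUnique (Fin 1) (Fin d)) _ _ fun x => rfl
  have hiff : (∀ x : Fin 1 → Fin d, s (x 0) = 0 → p (x 0) = 0) ↔ ∀ i, s i = 0 → p i = 0 :=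
    ⟨fun h i => h fun _ => i, fun h x => h _⟩
  rw [tpow_spec, tpow_spec, Dsand_spec (tpow_unitary hU 1)
    (fun x => Finset.prod_nonneg fun i _ => hp _) (fun x => Finset.prod_nonneg fun i _ => hs _) hα]
  simp only [Fin.prod_univ_one, hsum, hiff]

theorem sum_prod_rpow_mul_prod_rpow {p s : Fin d → ℝ} (hp : ∀ i, 0 ≤ p i) (hs : ∀ i, 0 ≤ s i)
    (α β : ℝ) (n : ℕ) :
    ∑ x : Fin n → Fin d, (∏ k, p (x k)) ^ α * (∏ k, s (x k)) ^ β =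
      (∑ i, p i ^ α * s i ^ β) ^ n := by
  rw [Fintype.sum_pow]
  refine Finset.sum_congr rfl fun x _ => ?_
  rw [← Real.finsetProd_rpow _ _ (fun k _ => hp _), ← Real.finsetProd_rpow _ _ (fun k _ => hs _),
    Finset.prod_mul_distrib]

theorem sum_rpow_mul_rpow_pos {p s : Fin d → ℝ} (hp : ∀ i, 0 ≤ p i) (hp1 : ∑ i, p i = 1)
    (hs : ∀ i, 0 ≤ s i) (hps : ∀ i, s i = 0 → p i = 0) (α β : ℝ) :
    0 < ∑ i, p i ^ α * s i ^ β := by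
  obtain ⟨i, hi, hpi⟩ := Finset.exists_ne_zero_of_sum_ne_zero (hp1.trans_ne one_ne_zero)
  refine Finset.sum_pos' (fun j _ => mul_nonneg (Real.rpow_nonneg (hp j) _)
    (Real.rpow_nonneg (hs j) _)) ⟨i, hi, ?_⟩
  exact mul_pos (Real.rpow_pos_of_pos (lt_of_le_of_ne (hp i) hpi.symm) _)
    (Real.rpow_pos_of_pos (lt_of_le_of_ne (hs i) fun h => hpi (hps i h.symm)) _)

/-- The success probability of a test for `ρ^{⊗n}` in terms of its error for `σ^{⊗n}`. -/
theorem rtr_tpow_mul_le (hU : star U * U = 1) {p s : Fin d → ℝ} (hp : ∀ i, 0 ≤ p i)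
    (hp1 : ∑ i, p i = 1) (hs : ∀ i, 0 ≤ s i) (hps : ∀ i, s i = 0 → p i = 0) {α : ℝ} (hα : 1 < α)
    {n : ℕ} {T : Matrix (Fin n → Fin d) (Fin n → Fin d) ℂ} (hT : IsTest T) {c : ℝ}
    (hc : rtr (tpow (spec U s) n * T) ≤ Real.exp (-(n * c))) :
    rtr (tpow (spec U p) n * T) ≤ Real.exp (-(n * ((α - 1) / α *
      (c - (α - 1)⁻¹ * Real.log (∑ i, p i ^ α * s i ^ (1 - α)))))) := by
  have hQ := sum_rpow_mul_rpow_pos hp hp1 hs hps α (1 - α)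
  set Q := ∑ i, p i ^ α * s i ^ (1 - α) with hQdef
  have hV := tpow_unitary hU n
  rw [tpow_spec, rtr_spec_mul] at hc ⊢
  refine (sum_mul_le_of_sum_mul_le (fun x => Finset.prod_nonneg fun k _ => hp _)
    (fun x => Finset.prod_nonneg fun k _ => hs _) (fun x => (hT.diag_mem_Icc hV x).1)
    (fun x => (hT.diag_mem_Icc hV x).2) (fun x hx => ?_) hα (pow_pos hQ n) (Real.exp_pos _)
    (sum_prod_rpow_mul_prod_rpow hp hs α (1 - α) n).le hc).trans_eq ?_
  · obtain ⟨k, hk, h⟩ := Finset.prod_eq_zero_iff.1 hx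
    exact Finset.prod_eq_zero hk (hps _ h)
  · have h1 : α - 1 ≠ 0 := (sub_pos.2 hα).ne'
    have h2 : α ≠ 0 := by linarith
    rw [Real.rpow_def_of_pos (pow_pos hQ n), Real.log_pow, ← Real.exp_mul, ← Real.exp_add]
    congr 1
    field_simp
    ring

variable {S : (n : ℕ) → Set (Matrix (Fin n → Fin d) (Fin n → Fin d) ℂ)}

theorem le_limsup_rate (hS : Assumption1 S) (hU : star U * U = 1) {p s : Fin d → ℝ}
    (hp : ∀ i, 0 ≤ p i) (hp1 : ∑ i, p i = 1) (hs : ∀ i, 0 ≤ s i) (hps : ∀ i, s i = 0 → p i = 0)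
    (hsS : tpow (spec U s) 1 ∈ S 1) {α : ℝ} (hα : 1 < α)
    {T : (n : ℕ) → Matrix (Fin n → Fin d) (Fin n → Fin d) ℂ} (hT : ∀ n, IsTest (T n)) {r : ℝ}
    (hr : (r : EReal) ≤ liminf (fun n => rate n (typeII (S n) (T n))) atTop) :
    (((α - 1) / α * (r - (α - 1)⁻¹ * Real.log (∑ i, p i ^ α * s i ^ (1 - α))) : ℝ) : EReal) ≤
      limsup (fun n => rate n (rtr (tpow (spec U p) n * T n))) atTop := by
  set L := Real.log (∑ i, p i ^ α * s i ^ (1 - α)) with hL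
  have hcont : Continuous fun c : ℝ => (((α - 1) / α * (c - (α - 1)⁻¹ * L) : ℝ) : EReal) :=
    continuous_coe_real_ereal.comp (by fun_prop)
  refine le_of_tendsto ((hcont.tendsto r).mono_left (nhdsWithin_le_nhds (s := Iio r))) ?_
  filter_upwards [self_mem_nhdsWithin] with c hc
  refine le_limsup_of_frequently_le (Eventually.frequently ?_)
  filter_upwards [eventually_ge_atTop 1,
    eventually_lt_of_lt_liminf ((EReal.coe_lt_coe_iff.2 hc).trans_le hr)] with n hn hcn
  rw [coe_le_rate_iff hn]
  refine rtr_tpow_mul_le hU hp hp1 hs hps hα (hT n) ?_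
  exact (rtr_mul_le_typeII (hS.compact n hn) (hS.tpow_mem hsS hn) _).trans
    ((coe_le_rate_iff hn).1 hcn.le)

/-- The likelihood-ratio tests given by weights in the polar set. -/
theorem exists_tests (hS : Assumption1 S) (hU : star U * U = 1) {X : Fin d → ℝ}
    (hX0 : ∀ i, 0 ≤ X i) (hX : tpow (spec U X) 1 ∈ polar (S 1)) (r : ℝ) (p : Fin d → ℝ) :
    ∃ T : (n : ℕ) → Matrix (Fin n → Fin d) (Fin n → Fin d) ℂ, (∀ n, IsTest (T n)) ∧
      (r : EReal) ≤ liminf (fun n => rate n (typeII (S n) (T n))) atTop ∧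
      ∀ n, rtr (tpow (spec U p) n * T n) =
        ∑ x : Fin n → Fin d, min 1 (∏ k, X (x k) * Real.exp (-r)) * ∏ k, p (x k) := by
  have hf0 : ∀ n (x : Fin n → Fin d), 0 ≤ min 1 (∏ k, X (x k) * Real.exp (-r)) := fun n x =>
    le_min zero_le_one (Finset.prod_nonneg fun k _ => mul_nonneg (hX0 _) (Real.exp_pos _).le)
  refine ⟨fun n => spec (tpow U n) fun x => min 1 (∏ k, X (x k) * Real.exp (-r)),
    fun n => isTest_spec (tpow_unitary hU n) (hf0 n) fun x => min_le_left _ _, ?_, fun n => ?_⟩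
  · refine le_liminf_of_le (by isBoundedDefault) ?_
    filter_upwards [eventually_ge_atTop 1] with n hn
    rw [coe_le_rate_iff hn]
    refine Real.sSup_le ?_ (Real.exp_pos _).le
    rintro _ ⟨σ, hσ, rfl⟩
    have h1 := (hS.tpow_mem_polar hX hn).2 σ hσ
    have h2 : 0 ≤ rtr (((Real.exp (-(n * r)) : ℝ) : ℂ) • tpow (spec U X) n * σ -
        spec (tpow U n) (fun x => min 1 (∏ k, X (x k) * Real.exp (-r))) * σ) := by
      rw [← sub_mul, tpow_spec, spec_smul, spec_sub]
      refine rtr_mul_nonneg (spec_posSemidef fun x => sub_nonneg.2 ?_) (hS.psd n hn σ hσ)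
      refine (min_le_right _ _).trans_eq ?_
      rw [Finset.prod_mul_distrib, Finset.prod_const, Finset.card_univ, Fintype.card_fin,
        ← Real.exp_nat_mul, mul_comm, mul_neg]
    rw [rtr_sub, rtr_smul_mul] at h2
    have h3 := mul_le_mul_of_nonneg_left h1 (Real.exp_pos (-(n * r))).le
    simp only [rtr_mul_comm σ]
    linarith
  · rw [tpow_spec, spec_mul_spec (tpow_unitary hU n), rtr_spec (tpow_unitary hU n)]
    exact Finset.sum_congr rfl fun x _ => mul_comm _ _

theorem limsup_rate_le {f : ℕ → ℝ} {A C : ℝ} (hf : ∀ n : ℕ, Real.exp (-(n * A + C * √n)) ≤ f n) :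
    limsup (fun n => rate n (f n)) atTop ≤ (A : EReal) := by
  have ht : Tendsto (fun n : ℕ => ((A + C * (√(n : ℝ))⁻¹ : ℝ) : EReal)) atTop
      (nhds (A : EReal)) := by
    refine continuous_coe_real_ereal.continuousAt.tendsto.comp ?_
    have h1 : Tendsto (fun n : ℕ => (√(n : ℝ))⁻¹) atTop (nhds 0) :=
      tendsto_inv_atTop_zero.comp (Real.tendsto_sqrt_atTop.comp tendsto_natCast_atTop_atTop)
    simpa using (h1.const_mul C).const_add A
  rw [← ht.limsup_eq]
  refine limsup_le_limsup ((eventually_ge_atTop 1).mono fun n hn => ?_)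
  change rate n (f n) ≤ _
  rw [rate_le_coe_iff hn]
  refine le_trans (Real.exp_le_exp.2 (le_of_eq ?_)) (hf n)
  have h0 : (0 : ℝ) < √n := Real.sqrt_pos.2 (by exact_mod_cast hn)
  have h2 : (n : ℝ) = √n * √n := (Real.mul_self_sqrt (Nat.cast_nonneg n)).symm
  have h3 : (n : ℝ) * (C * (√n)⁻¹) = C * √n := by
    nth_rewrite 1 [h2]
    field_simp
  rw [mul_add, h3]

end Testing

section Achievability

variable {d : ℕ} {U : Matrix (Fin d) (Fin d) ℂ}

theorem nonneg_of_tpow_spec_posSemidef (hU : star U * U = 1) {a : Fin d → ℝ}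
    (ha : (tpow (spec U a) 1).PosSemidef) (i : Fin d) : 0 ≤ a i := by
  rw [tpow_spec] at ha
  simpa using nonneg_of_spec_posSemidef (tpow_unitary hU 1) ha fun _ => i

theorem rtr_tpow_spec_mul_tpow_spec (hU : star U * U = 1) (a b : Fin d → ℝ) :
    rtr (tpow (spec U a) 1 * tpow (spec U b) 1) = ∑ i, a i * b i := by
  rw [← tpow_mul, spec_mul_spec hU, tpow_spec, rtr_spec (tpow_unitary hU 1),
    ← Fintype.sum_pow (fun i => a i * b i), pow_one]

/-- The eigenvalue vector, in the basis `U`, of an operator on `H^{⊗1}`. -/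
def eigenvaluesIn (U : Matrix (Fin d) (Fin d) ℂ) (A : Matrix (Fin 1 → Fin d) (Fin 1 → Fin d) ℂ)
    (i : Fin d) : ℝ :=
  ((star (tpow U 1) * A * tpow U 1) (fun _ => i) (fun _ => i)).re

theorem isLinearMap_eigenvaluesIn (U : Matrix (Fin d) (Fin d) ℂ) :
    IsLinearMap ℝ (eigenvaluesIn U) := by
  constructor
  · intro A B
    ext i
    simp [eigenvaluesIn, mul_add, add_mul]
  · intro c A
    ext i
    simp [eigenvaluesIn]

theorem continuous_eigenvaluesIn (U : Matrix (Fin d) (Fin d) ℂ) :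
    Continuous (eigenvaluesIn U) := by
  refine continuous_pi fun i => Complex.continuous_re.comp ?_
  exact ((continuous_const.matrix_mul continuous_id).matrix_mul continuous_const).matrix_elem _ _

theorem eigenvaluesIn_tpow_spec (hU : star U * U = 1) (a : Fin d → ℝ) :
    eigenvaluesIn U (tpow (spec U a) 1) = a := by
  ext i
  rw [eigenvaluesIn, tpow_spec, spec_apply_conj (tpow_unitary hU 1)]
  simp

theorem scExp_le {S : (n : ℕ) → Set (Matrix (Fin n → Fin d) (Fin n → Fin d) ℂ)}
    (hS : Assumption1 S) (hU : star U * U = 1) {p : Fin d → ℝ} (hp : ∀ i, 0 ≤ p i)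
    (hp1 : (spec U p).trace = 1) (hdiag : ∀ A ∈ S 1, ∃ a : Fin d → ℝ, A = tpow (spec U a) 1)
    {τ : Fin d → ℝ} (hτ : tpow (spec U τ) 1 ∈ S 1) (hτp : ∀ i, p i ≠ 0 → 0 < τ i) {r R : ℝ}
    (hR : ∀ t > 0, ∀ s : Fin d → ℝ, tpow (spec U s) 1 ∈ S 1 → (∀ i, p i ≠ 0 → 0 < s i) →
      (t * r - Real.log (partitionFn p s t)) / (1 + t) ≤ R) :
    scExp r (spec U p) S ≤ (R : EReal) := by
  have hsum : ∑ i, p i = 1 := by rw [← rtr_spec hU, rtr, hp1, Complex.one_re]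
  have hmem : ∀ a ∈ eigenvaluesIn U '' S 1, tpow (spec U a) 1 ∈ S 1 := by
    rintro _ ⟨A, hA, rfl⟩
    obtain ⟨a, rfl⟩ := hdiag A hA
    rwa [eigenvaluesIn_tpow_spec hU]
  have hcont : Continuous fun ε : ℝ => ((R + ε : ℝ) : EReal) :=
    continuous_coe_real_ereal.comp (by fun_prop)
  have hlim := (hcont.tendsto 0).mono_left (nhdsWithin_le_nhds (s := Ioi 0))
  rw [add_zero] at hlim
  refine ge_of_tendsto hlim ?_
  filter_upwards [self_mem_nhdsWithin] with ε hε
  obtain ⟨q, X, hq0, hq1, hX0, hqp, hXK, hle⟩ := exists_polar_weights hp hsum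
    ((hS.convex 1 le_rfl).is_linear_image (isLinearMap_eigenvaluesIn U))
    ((hS.compact 1 le_rfl).image (continuous_eigenvaluesIn U))
    (fun a ha => nonneg_of_tpow_spec_posSemidef hU (hS.psd 1 le_rfl _ (hmem a ha)))
    ⟨_, hτ, eigenvaluesIn_tpow_spec hU τ⟩ hτp (fun t ht s hs => hR t ht s (hmem s hs)) hε
  have hX : tpow (spec U X) 1 ∈ polar (S 1) := by
    refine ⟨?_, fun Y hY => ?_⟩
    · rw [tpow_spec]
      exact spec_posSemidef fun x => Finset.prod_nonneg fun k _ => hX0 _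
    · obtain ⟨a, rfl⟩ := hdiag Y hY
      rw [rtr_tpow_spec_mul_tpow_spec hU]
      exact hXK a ⟨_, hY, eigenvaluesIn_tpow_spec hU a⟩
  obtain ⟨T, hT, hTr, hTp⟩ := exists_tests hS hU hX0 hX r p
  obtain ⟨C, hC⟩ := le_sum_prod_mul_min hp hq0 hq1 hX0 hqp r
  refine (iInf_le _ ⟨T, hT, hTr⟩).trans ?_
  simp only [one_sub_typeI hp1, hTp]
  exact (limsup_rate_le hC).trans (EReal.coe_le_coe_iff.2 hle)

end Achievability

/-- Theorem 36 of the paper: single-letter characterization of the strong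
converse exponent in the commutative case.  The supremum over `α ∈ [1,+∞]` is the
maximum of the supremum over `α ∈ [1,∞)` and the `α = +∞` term. -/
theorem strong_converse_exponent_commutative {d : ℕ}
    (ρ : Matrix (Fin d) (Fin d) ℂ) (hρ : IsState ρ)
    (S : (n : ℕ) → Set (Matrix (Fin n → Fin d) (Fin n → Fin d) ℂ))
    (hS : Assumption1 S)
    (hsupp : ∃ τ ∈ S 1, IsState τ ∧ msupp (tpow ρ 1) ≤ msupp τ)
    (hcommS : ∀ n : ℕ, 1 ≤ n → ∀ A ∈ S n, ∀ B ∈ S n, A * B = B * A)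
    (hcommρ : ∀ n : ℕ, 1 ≤ n → ∀ A ∈ S n, A * tpow ρ n = tpow ρ n * A)
    (r : ℝ) (hr : 0 < r) :
    scExp r ρ S =
      max (⨆ α ∈ Set.Ici (1 : ℝ), ⨆ σ ∈ S 1,
          (((α - 1) / α : ℝ) : EReal) * ((r : EReal) - Dsand α (tpow ρ 1) σ))
        (⨆ σ ∈ S 1, (r : EReal) - DsandInf (tpow ρ 1) σ) := by
  obtain ⟨U, hU, ⟨p, rfl⟩, hdiag⟩ :=
    exists_eigenbasis hS hρ.1.1 (hcommS 1 le_rfl) (hcommρ 1 le_rfl)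
  have hp := nonneg_of_spec_posSemidef hU hρ.1
  have hp1 : ∑ i, p i = 1 := by rw [← rtr_spec hU, rtr, hρ.2, Complex.one_re]
  have hnonneg : ∀ a, tpow (spec U a) 1 ∈ S 1 → ∀ i, 0 ≤ a i := fun a ha i =>
    nonneg_of_tpow_spec_posSemidef hU (hS.psd 1 le_rfl _ ha) i
  set s := ⨆ α ∈ Set.Ici (1 : ℝ), ⨆ σ ∈ S 1,
    (((α - 1) / α : ℝ) : EReal) * ((r : EReal) - Dsand α (tpow (spec U p) 1) σ) with hs
  have hle : ∀ α ≥ 1, ∀ σ ∈ S 1,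
      (((α - 1) / α : ℝ) : EReal) * ((r : EReal) - Dsand α (tpow (spec U p) 1) σ) ≤ s :=
    fun α hα σ hσ => (le_iSup₂ (f := fun σ (_ : σ ∈ S 1) =>
      (((α - 1) / α : ℝ) : EReal) * ((r : EReal) - Dsand α (tpow (spec U p) 1) σ)) σ hσ).trans
        (le_iSup₂ (f := fun α (_ : α ∈ Set.Ici (1 : ℝ)) => ⨆ σ ∈ S 1,
          (((α - 1) / α : ℝ) : EReal) * ((r : EReal) - Dsand α (tpow (spec U p) 1) σ)) α hα)
  obtain ⟨τ, hτ, -, hτp⟩ := hsupp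
  have hs0 : 0 ≤ s := by simpa using hle 1 le_rfl τ hτ
  rw [max_eq_left]
  · refine le_antisymm ?_ (le_iInf fun T => iSup₂_le fun α hα => iSup₂_le fun σ hσ => ?_)
    · obtain ⟨t, rfl⟩ := hdiag τ hτ
      rw [tpow_spec, tpow_spec, msupp_spec_le_iff (tpow_unitary hU 1)] at hτp
      have htp : ∀ i, p i ≠ 0 → 0 < t i := fun i hi =>
        lt_of_le_of_ne (hnonneg t hτ i) fun h => hi (by simpa [h] using hτp fun _ => i)
      induction hsR : s with
      | bot => simp [hsR] at hs0
      | top => exact le_top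
      | coe R =>
        refine scExp_le hS hU hp hρ.2 hdiag hτ htp fun u hu a ha hap => ?_
        have hterm := hle (1 + u) (by linarith) _ ha
        have hps : ∀ i, a i = 0 → p i = 0 := fun i hi => by
          by_contra hne
          exact (hap i hne).ne' hi
        rw [Dsand_tpow_one hU hp (hnonneg a ha) (by linarith), if_pos hps,
          ← partitionFn_eq_sum_rpow hp hap hu, hsR, ← EReal.coe_sub, ← EReal.coe_mul,
          EReal.coe_le_coe_iff] at hterm
        refine (le_of_eq ?_).trans hterm
        rw [add_sub_cancel_left]
        field_simp
    · simp only [one_sub_typeI hρ.2]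
      obtain ⟨a, rfl⟩ := hdiag σ hσ
      rcases eq_or_lt_of_le (show (1 : ℝ) ≤ α from hα) with rfl | hα
      · simp only [sub_self, zero_div, EReal.coe_zero, zero_mul]
        refine le_limsup_of_frequently_le (Eventually.frequently ?_)
        filter_upwards [eventually_ge_atTop 1] with n hn
        rw [← EReal.coe_zero, coe_le_rate_iff hn, ← one_sub_typeI hρ.2, mul_zero, neg_zero,
          Real.exp_zero, sub_le_self_iff, typeI, tpow_spec]
        exact rtr_mul_nonneg (T.2.1 n).2
          (spec_posSemidef fun x => Finset.prod_nonneg fun k _ => hp _)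
      · rw [Dsand_tpow_one hU hp (hnonneg a hσ) hα]
        split_ifs with hps
        · rw [← EReal.coe_sub, ← EReal.coe_mul]
          exact le_limsup_rate hS hU hp hp1 (hnonneg a hσ) hps hσ hα T.2.1 T.2.2
        · rw [EReal.sub_top, EReal.coe_mul_bot_of_pos (div_pos (by linarith) (by linarith))]
          exact bot_le
  · refine iSup₂_le fun σ hσ => sub_limsup_le ?_ hs0 fun α hα => hle α hα.le σ hσ
    obtain ⟨a, rfl⟩ := hdiag σ hσ
    by_cases hps : ∀ i, a i = 0 → p i = 0
    · refine Or.inr fun α hα => ?_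
      rw [Dsand_tpow_one hU hp (hnonneg a hσ) hα, if_pos hps]
      exact ⟨_, rfl⟩
    · refine Or.inl fun α hα => ?_
      rw [Dsand_tpow_one hU hp (hnonneg a hσ) hα, if_neg hps]

end QHT
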